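/- Let J ∈ ℕ and F ∈ C(ℝ^J) satisfy the convexity-ellipticity structure with functions α_j and constant θ₀ > 0. Given s ∈ (0,1), let K₁,…,K_J be kernels satisfying the evenness and two-sided power bounds and the derivative bounds, let f and g₁,…,g_J be Lipschitz functions in B_R ⊂ ℝ^n, and let u ∈ C^∞(ℝ^n) ∩ W^{1,∞}(ℝ^n) be a solution of F( 𝓛_{K₁}u − g₁, …, 𝓛_{K_J}u − g_J ) = f everywhere in B_R. Set g(x) := −F(−g₁(x),…,−g_J(x)). Then sup_{B_{R/2}} |∇u| ≤ C R^{-1} ‖u‖_{L^∞(ℝ^n)} + C R^{-1+s} ‖(f+g)₋‖_{L^∞(B_R)}^{1/2} ‖u‖_{L^∞(B_R)}^{1/2} + C R^{2s} γ₁, for some constant C depending only on the structural constants n, s, C₁, C₂, C₃ and on θ₀. -/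

import Mathlib

open MeasureTheory Filter Metric Set

noncomputable section

/-- Euclidean space `ℝⁿ`. -/
abbrev En (n : ℕ) := EuclideanSpace ℝ (Fin n)

/-- Principal value integral centered at `x`: the limit, as `ε → 0⁺`, of the integrals
over the complement of the `ε`-ball centered at `x`. -/
def pvAt (n : ℕ) (x : En n) (g : En n → ℝ) : ℝ :=
  limUnder (nhdsWithin (0:ℝ) (Set.Ioi 0))
    (fun ε => ∫ y in {y : En n | ε ≤ dist y x}, g y)

/-- Integro-differential operator with kernel `K`:
`𝓛_K u (x) = P.V. ∫ (u x - u y) K (x - y) dy`. -/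
def opK (n : ℕ) (K : En n → ℝ) (u : En n → ℝ) (x : En n) : ℝ :=
  pvAt n x (fun y => (u x - u y) * K (x - y))

/-- The normalizing constant `c_{n,s}` of the fractional Laplacian, for which the
Fourier symbol is `|ξ|^{2s}`. -/
def cns (n : ℕ) (s : ℝ) : ℝ :=
  (4:ℝ) ^ s * s * Real.Gamma ((n:ℝ)/2 + s) / (Real.pi ^ ((n:ℝ)/2) * Real.Gamma (1 - s))

/-- The fractional Laplacian `(-Δ)^s`, for `s ∈ (0,1)`. -/
def fracLap (n : ℕ) (s : ℝ) (u : En n → ℝ) (x : En n) : ℝ :=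
  opK n (fun z => cns n s * ‖z‖ ^ (-((n:ℝ) + 2*s))) u x

/-- Directional derivative `∂_e u`. -/
def dd (n : ℕ) (e : En n) (u : En n → ℝ) (x : En n) : ℝ := fderiv ℝ u x e

/-- Second directional derivative `∂²_e u`. -/
def dd2 (n : ℕ) (e : En n) (u : En n → ℝ) (x : En n) : ℝ := fderiv ℝ (dd n e u) x e

/-- `‖η‖_{C²(ℝⁿ)} ≤ M`. -/
def C2BddBy (n : ℕ) (η : En n → ℝ) (M : ℝ) : Prop :=
  ∀ x : En n, |η x| ≤ M ∧ ‖fderiv ℝ η x‖ ≤ M ∧ ‖fderiv ℝ (fderiv ℝ η) x‖ ≤ M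

/-- The kernel `K` is even and has two-sided power bounds with constants `C₁ ≤ C₂`:
`K(z) = K(-z)` and `C₁ s(1-s)|z|^{-n-2s} ≤ K(z) ≤ C₂ s(1-s)|z|^{-n-2s}` for `z ≠ 0`. -/
def evenPowKernel (n : ℕ) (s C₁ C₂ : ℝ) (K : En n → ℝ) : Prop :=
  (∀ z : En n, z ≠ 0 → K z = K (-z)) ∧
  (∀ z : En n, z ≠ 0 →
    C₁ * (s * (1 - s)) * ‖z‖ ^ (-((n:ℝ) + 2*s)) ≤ K z ∧
    K z ≤ C₂ * (s * (1 - s)) * ‖z‖ ^ (-((n:ℝ) + 2*s)))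

/-- `K ∈ C²(ℝⁿ \ {0})` with `|z||∇K(z)| + |z|²|D²K(z)| ≤ C₃ K(z)` for `z ≠ 0`. -/
def kernelDerivBdd (n : ℕ) (C₃ : ℝ) (K : En n → ℝ) : Prop :=
  ContDiffOn ℝ 2 K {z : En n | z ≠ 0} ∧
  ∀ z : En n, z ≠ 0 →
    ‖z‖ * ‖fderiv ℝ K z‖ + ‖z‖^2 * ‖fderiv ℝ (fderiv ℝ K) z‖ ≤ C₃ * K z

/-- The weight `min (‖z‖² / r²) 1 · ‖z‖ ^ (-(n + 2s))`, which dominates every integrand below. -/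
def levyWeight (n : ℕ) (s r : ℝ) (z : En n) : ℝ :=
  min ((r⁻¹ * ‖z‖) ^ 2) 1 * ‖z‖ ^ (-((n:ℝ) + 2*s))

theorem levyWeight_nonneg (n : ℕ) (s r : ℝ) (z : En n) : 0 ≤ levyWeight n s r z := by
  unfold levyWeight
  positivity

theorem nontrivial_En {n : ℕ} (hn : 0 < n) : Nontrivial (En n) := by
  have : Nonempty (Fin n) := ⟨⟨0, hn⟩⟩
  infer_instance

theorem integrable_levyWeight_one {n : ℕ} (hn : 0 < n) {s : ℝ} (hs : s ∈ Ioo (0:ℝ) 1) :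
    Integrable (levyWeight n s 1) := by
  have := nontrivial_En hn
  have key : Integrable (fun z : En n =>
      (fun t : ℝ => min (t ^ 2) 1 * t ^ (-((n:ℝ) + 2*s))) ‖z‖) volume := by
    refine (integrable_fun_norm_addHaar volume
      (f := fun t : ℝ => min (t ^ 2) 1 * t ^ (-((n:ℝ) + 2*s)))).2 ?_
    have hdim : Module.finrank ℝ (En n) = n := by simp
    rw [hdim, ← Ioc_union_Ioi_eq_Ioi (zero_le_one' ℝ)]
    have hpow : ∀ y : ℝ, 0 < y → y ^ (n - 1) = y ^ ((n:ℝ) - 1) := by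
      intro y hy
      rw [← Real.rpow_natCast, Nat.cast_sub hn, Nat.cast_one]
    refine IntegrableOn.union ?_ ?_
    · have h1 : IntegrableOn (fun y : ℝ => y ^ (1 - 2 * s)) (Ioc 0 1) := by
        rw [← intervalIntegrable_iff_integrableOn_Ioc_of_le zero_le_one]
        exact intervalIntegral.intervalIntegrable_rpow' (by linarith [hs.2])
      refine h1.congr_fun ?_ measurableSet_Ioc
      intro y hy
      have hy0 : 0 < y := hy.1
      have hm : min (y ^ 2) 1 = y ^ (2:ℝ) := by
        rw [min_eq_left (by nlinarith [hy.2])]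
        norm_cast
      simp only [smul_eq_mul]
      rw [hm, hpow y hy0, ← Real.rpow_add hy0, ← Real.rpow_add hy0]
      ring_nf
    · have h1 : IntegrableOn (fun y : ℝ => y ^ (-1 - 2 * s)) (Ioi 1) :=
        integrableOn_Ioi_rpow_of_lt (by linarith [hs.1]) one_pos
      refine h1.congr_fun ?_ measurableSet_Ioi
      intro y hy
      have hy1 : (1:ℝ) < y := hy
      have hy0 : 0 < y := by linarith
      simp only [smul_eq_mul]
      rw [min_eq_right (by nlinarith), hpow y hy0, one_mul, ← Real.rpow_add hy0]
      ring_nf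
  refine key.congr (Eventually.of_forall fun z => ?_)
  simp [levyWeight]

theorem levyWeight_scale (n : ℕ) (s : ℝ) {r : ℝ} (hr : 0 < r) (z : En n) :
    levyWeight n s r z = r ^ (-((n:ℝ) + 2*s)) * levyWeight n s 1 (r⁻¹ • z) := by
  unfold levyWeight
  rw [norm_smul, norm_inv, Real.norm_of_nonneg hr.le,
    Real.mul_rpow (by positivity) (norm_nonneg z), Real.inv_rpow hr.le, inv_one, one_mul]
  have : r ^ (-((n:ℝ) + 2*s)) ≠ 0 := (Real.rpow_pos_of_pos hr _).ne'
  field_simp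

theorem integrable_levyWeight {n : ℕ} (hn : 0 < n) {s : ℝ} (hs : s ∈ Ioo (0:ℝ) 1) {r : ℝ}
    (hr : 0 < r) : Integrable (levyWeight n s r) := by
  have h := ((integrable_comp_smul_iff volume (levyWeight n s 1) (inv_ne_zero hr.ne')).2
    (integrable_levyWeight_one hn hs)).const_mul (r ^ (-((n:ℝ) + 2*s)))
  exact h.congr (Eventually.of_forall fun z => (levyWeight_scale n s hr z).symm)

theorem integral_levyWeight (n : ℕ) (s : ℝ) {r : ℝ} (hr : 0 < r) :
    ∫ z, levyWeight n s r z = r ^ (-(2*s)) * ∫ z, levyWeight n s 1 z := by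
  simp_rw [levyWeight_scale n s hr]
  rw [integral_const_mul, Measure.integral_comp_inv_smul, abs_of_nonneg (by positivity),
    smul_eq_mul, ← mul_assoc]
  congr 1
  rw [finrank_euclideanSpace_fin, ← Real.rpow_natCast, ← Real.rpow_add hr]
  ring_nf

/-- Even kernels comparable to `‖z‖ ^ (-(n + 2s))` that are differentiable away from the origin,
with the scale-invariant bound on the gradient. -/
structure BernsteinKernel (n : ℕ) (s c₁ c₂ c₃ : ℝ) (K : En n → ℝ) : Prop where
  even : ∀ z, z ≠ 0 → K z = K (-z)
  lower : ∀ z, z ≠ 0 → c₁ * ‖z‖ ^ (-((n:ℝ) + 2*s)) ≤ K z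
  upper : ∀ z, z ≠ 0 → K z ≤ c₂ * ‖z‖ ^ (-((n:ℝ) + 2*s))
  diff : ∀ z, z ≠ 0 → DifferentiableAt ℝ K z
  deriv_le : ∀ z, z ≠ 0 → ‖z‖ * ‖fderiv ℝ K z‖ ≤ c₃ * K z

theorem ae_ne_zero {n : ℕ} (hn : 0 < n) : ∀ᵐ z : En n, z ≠ 0 := by
  have := nontrivial_En hn
  exact Measure.ae_ne volume 0

namespace BernsteinKernel

variable {n : ℕ} {s c₁ c₂ c₃ : ℝ} {K : En n → ℝ}

theorem nonneg (hK : BernsteinKernel n s c₁ c₂ c₃ K) (hc₁ : 0 ≤ c₁) {z : En n} (hz : z ≠ 0) :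
    0 ≤ K z :=
  le_trans (by positivity) (hK.lower z hz)

theorem aestronglyMeasurable (hK : BernsteinKernel n s c₁ c₂ c₃ K) (hn : 0 < n) :
    AEStronglyMeasurable K volume := by
  have := nontrivial_En hn
  have h : ContinuousOn K ({0}ᶜ : Set (En n)) := fun z hz =>
    (hK.diff z hz).continuousAt.continuousWithinAt
  have h2 := h.aestronglyMeasurable (μ := volume) (measurableSet_singleton (0 : En n)).compl
  rwa [Measure.restrict_eq_self_of_ae_mem (s := ({0}ᶜ : Set (En n))) (ae_ne_zero hn)] at h2

theorem norm_mul_le (hK : BernsteinKernel n s c₁ c₂ c₃ K) (hc₁ : 0 ≤ c₁) {r a C : ℝ}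
    {z : En n} (hz : z ≠ 0) (ha : |a| ≤ C * min ((r⁻¹ * ‖z‖) ^ 2) 1) :
    |a * K z| ≤ C * c₂ * levyWeight n s r z := by
  rw [abs_mul, abs_of_nonneg (hK.nonneg hc₁ hz)]
  calc |a| * K z ≤ (C * min ((r⁻¹ * ‖z‖) ^ 2) 1) * (c₂ * ‖z‖ ^ (-((n:ℝ) + 2*s))) :=
        mul_le_mul ha (hK.upper z hz) (hK.nonneg hc₁ hz) ((abs_nonneg a).trans ha)
    _ = C * c₂ * levyWeight n s r z := by unfold levyWeight; ring

theorem integrable_mul (hK : BernsteinKernel n s c₁ c₂ c₃ K) (hn : 0 < n) (hs : s ∈ Ioo (0:ℝ) 1)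
    (hc₁ : 0 ≤ c₁) {r : ℝ} (hr : 0 < r) {h : En n → ℝ} {C : ℝ}
    (hm : AEStronglyMeasurable h volume) (hh : ∀ z, z ≠ 0 → |h z| ≤ C * min ((r⁻¹ * ‖z‖) ^ 2) 1) :
    Integrable (fun z => h z * K z) := by
  refine ((integrable_levyWeight hn hs hr).const_mul (C * c₂)).mono'
    (hm.mul (hK.aestronglyMeasurable hn)) ?_
  filter_upwards [ae_ne_zero hn] with z hz
  exact hK.norm_mul_le hc₁ hz (hh z hz)

theorem integral_mul_le (hK : BernsteinKernel n s c₁ c₂ c₃ K) (hn : 0 < n) (hs : s ∈ Ioo (0:ℝ) 1)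
    (hc₁ : 0 ≤ c₁) {r : ℝ} (hr : 0 < r) {h : En n → ℝ} {C : ℝ}
    (hm : AEStronglyMeasurable h volume) (hh : ∀ z, z ≠ 0 → |h z| ≤ C * min ((r⁻¹ * ‖z‖) ^ 2) 1) :
    ∫ z, h z * K z ≤ C * c₂ * (r ^ (-(2*s)) * ∫ z, levyWeight n s 1 z) := by
  rw [← integral_levyWeight n s hr, ← integral_const_mul]
  refine integral_mono_ae (hK.integrable_mul hn hs hc₁ hr hm hh)
    ((integrable_levyWeight hn hs hr).const_mul _) ?_
  filter_upwards [ae_ne_zero hn] with z hz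
  exact (le_abs_self _).trans (hK.norm_mul_le hc₁ hz (hh z hz))

end BernsteinKernel

/-- The second difference `2 v(x) - v(x + z) - v(x - z)`. -/
def sdiff2 {n : ℕ} (v : En n → ℝ) (x z : En n) : ℝ := 2 * v x - v (x + z) - v (x - z)

theorem exists_sdiff2_le {n : ℕ} {v : En n → ℝ} (hv : ContDiff ℝ 2 v) {M : ℝ}
    (hM : ∀ x, |v x| ≤ M) (x₀ : En n) :
    ∃ C, 0 ≤ C ∧ ∀ x ∈ ball x₀ 1, ∀ z, |sdiff2 v x z| ≤ C * min ((1⁻¹ * ‖z‖) ^ 2) 1 := by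
  have hM0 : 0 ≤ M := (abs_nonneg _).trans (hM 0)
  have hd : ContDiff ℝ 1 (fderiv ℝ v) := hv.fderiv_right (by norm_num)
  have hdd : Continuous (fderiv ℝ (fderiv ℝ v)) := hd.continuous_fderiv (by norm_num)
  obtain ⟨B, hB⟩ := (isCompact_closedBall x₀ 2).exists_bound_of_continuousOn
    (f := fderiv ℝ (fderiv ℝ v)) hdd.continuousOn
  have hlip : ∀ a ∈ closedBall x₀ 2, ∀ b ∈ closedBall x₀ 2,
      ‖fderiv ℝ v b - fderiv ℝ v a‖ ≤ B * ‖b - a‖ := fun a ha b hb =>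
    Convex.norm_image_sub_le_of_norm_fderiv_le (𝕜 := ℝ)
      (fun y _ => hd.differentiable (by norm_num) y) hB (convex_closedBall x₀ 2) ha hb
  have hB0 : 0 ≤ B := (norm_nonneg _).trans (hB x₀ (mem_closedBall_self (by norm_num)))
  refine ⟨2 * B + 4 * M, by positivity, fun x hx z => ?_⟩
  rw [inv_one, one_mul]
  rcases le_total ‖z‖ 1 with hz | hz
  · rw [min_eq_left (by nlinarith [norm_nonneg z])]
    have hmem : ∀ t : ℝ, |t| ≤ 1 → x + t • z ∈ closedBall x₀ 2 := by
      intro t ht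
      rw [mem_closedBall]
      calc dist (x + t • z) x₀ ≤ dist (x + t • z) x + dist x x₀ := dist_triangle _ _ _
        _ ≤ 1 + 1 := by
          refine add_le_add ?_ (mem_ball.1 hx).le
          rw [dist_eq_norm, add_sub_cancel_left, norm_smul, Real.norm_eq_abs]
          nlinarith [norm_nonneg z, abs_nonneg t]
        _ = 2 := by norm_num
    have hder : ∀ t : ℝ, HasDerivAt (fun t : ℝ => v (x + t • z) + v (x + (-t) • z))
        (fderiv ℝ v (x + t • z) z - fderiv ℝ v (x + (-t) • z) z) t := by
      intro t
      have hvd := hv.differentiable (by norm_num)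
      have h1 : HasDerivAt (fun t : ℝ => x + t • z) z t := by
        simpa using ((hasDerivAt_id t).smul_const z).const_add x
      have h2 : HasDerivAt (fun t : ℝ => x + (-t) • z) (-z) t := by
        simpa using ((hasDerivAt_id t).neg.smul_const z).const_add x
      have h3 := (hvd (x + t • z)).hasFDerivAt.comp_hasDerivAt t h1
      have h4 := (hvd (x + (-t) • z)).hasFDerivAt.comp_hasDerivAt t h2
      have h5 := h3.add h4
      rw [map_neg, ← sub_eq_add_neg] at h5
      exact h5
    have hbd : ∀ t ∈ Icc (0:ℝ) 1,
        ‖fderiv ℝ v (x + t • z) z - fderiv ℝ v (x + (-t) • z) z‖ ≤ 2 * B * ‖z‖ ^ 2 := by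
      intro t ht
      have ht' : |t| ≤ 1 := by rw [abs_of_nonneg ht.1]; exact ht.2
      have h6 := hlip _ (hmem (-t) (by rwa [abs_neg])) _ (hmem t ht')
      have h7 : x + t • z - (x + (-t) • z) = (2 * t) • z := by
        rw [neg_smul, two_mul, add_smul]; abel
      rw [h7, norm_smul, Real.norm_of_nonneg (by linarith [ht.1])] at h6
      rw [← sub_apply]
      calc _ ≤ ‖fderiv ℝ v (x + t • z) - fderiv ℝ v (x + (-t) • z)‖ * ‖z‖ :=
            ContinuousLinearMap.le_opNorm _ _
        _ ≤ (B * (2 * t * ‖z‖)) * ‖z‖ := by gcongr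
        _ ≤ (B * (2 * 1 * ‖z‖)) * ‖z‖ := by gcongr; exact ht.2
        _ = 2 * B * ‖z‖ ^ 2 := by ring
    have h8 := Convex.norm_image_sub_le_of_norm_hasDerivWithin_le
      (fun t ht => (hder t).hasDerivWithinAt) hbd (convex_Icc 0 1)
      (left_mem_Icc.2 zero_le_one) (right_mem_Icc.2 zero_le_one)
    have h9 : |sdiff2 v x z| ≤ 2 * B * ‖z‖ ^ 2 := by
      rw [← abs_neg]
      convert h8 using 1
      · rw [Real.norm_eq_abs]
        congr 1
        simp [sdiff2, sub_eq_add_neg]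
        ring
      · simp
    nlinarith [sq_nonneg ‖z‖]
  · rw [min_eq_right (by nlinarith)]
    unfold sdiff2
    have h1 := abs_le.1 (hM x)
    have h2 := abs_le.1 (hM (x + z))
    have h3 := abs_le.1 (hM (x - z))
    rw [abs_le]
    constructor <;> linarith

theorem exists_sub_sq_le {n : ℕ} {v : En n → ℝ} (hv : ContDiff ℝ 1 v) {M : ℝ}
    (hM : ∀ x, |v x| ≤ M) (x : En n) :
    ∃ C, 0 ≤ C ∧ ∀ z, |(v x - v (x + z)) ^ 2| ≤ C * min ((1⁻¹ * ‖z‖) ^ 2) 1 := by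
  have hM0 : 0 ≤ M := (abs_nonneg _).trans (hM 0)
  have hd : Continuous (fderiv ℝ v) := hv.continuous_fderiv (by norm_num)
  obtain ⟨B, hB⟩ := (isCompact_closedBall x 1).exists_bound_of_continuousOn
    (f := fderiv ℝ v) hd.continuousOn
  have hB0 : 0 ≤ B := (norm_nonneg _).trans (hB x (mem_closedBall_self (by norm_num)))
  refine ⟨B ^ 2 + 4 * M ^ 2, by positivity, fun z => ?_⟩
  rw [inv_one, one_mul, abs_of_nonneg (sq_nonneg _)]
  rcases le_total ‖z‖ 1 with hz | hz
  · rw [min_eq_left (by nlinarith [norm_nonneg z])]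
    have h := Convex.norm_image_sub_le_of_norm_fderiv_le (𝕜 := ℝ)
      (fun y _ => hv.differentiable (by norm_num) y) hB (convex_closedBall x 1)
      (x := x + z) (y := x) (by simpa [mem_closedBall, dist_eq_norm] using hz)
      (mem_closedBall_self (by norm_num))
    rw [sub_add_cancel_left, norm_neg, Real.norm_eq_abs] at h
    have h2 := pow_le_pow_left₀ (abs_nonneg _) h 2
    rw [sq_abs, mul_pow] at h2
    nlinarith [mul_nonneg (sq_nonneg M) (sq_nonneg ‖z‖)]
  · rw [min_eq_right (by nlinarith)]
    have h1 := abs_le.1 (hM x)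
    have h2 := abs_le.1 (hM (x + z))
    nlinarith [sq_nonneg B]

theorem continuous_sdiff2 {n : ℕ} {v : En n → ℝ} (hv : Continuous v) (x : En n) :
    Continuous (sdiff2 v x) := by
  unfold sdiff2
  fun_prop

/-- The operator with kernel `K`, written as an absolutely convergent integral of second
differences. -/
def symmOp {n : ℕ} (K u : En n → ℝ) (x : En n) : ℝ := (1 / 2) * ∫ z, sdiff2 u x z * K z

namespace BernsteinKernel

variable {n : ℕ} {s c₁ c₂ c₃ : ℝ} {K : En n → ℝ}

theorem integrable_sdiff2_mul (hK : BernsteinKernel n s c₁ c₂ c₃ K) (hn : 0 < n)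
    (hs : s ∈ Ioo (0:ℝ) 1) (hc₁ : 0 ≤ c₁) {v : En n → ℝ} (hv : ContDiff ℝ 2 v) {M : ℝ}
    (hM : ∀ x, |v x| ≤ M) (x : En n) : Integrable (fun z => sdiff2 v x z * K z) := by
  obtain ⟨C, -, hC⟩ := exists_sdiff2_le hv hM x
  exact hK.integrable_mul hn hs hc₁ one_pos (continuous_sdiff2 hv.continuous x).aestronglyMeasurable
    fun z _ => hC x (mem_ball_self one_pos) z

theorem opK_eq_symmOp (hK : BernsteinKernel n s c₁ c₂ c₃ K) (hn : 0 < n)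
    (hs : s ∈ Ioo (0:ℝ) 1) (hc₁ : 0 ≤ c₁) {v : En n → ℝ} (hv : ContDiff ℝ 2 v) {M : ℝ}
    (hM : ∀ x, |v x| ≤ M) (x : En n) : opK n K v x = symmOp K v x := by
  have hM0 : 0 ≤ M := (abs_nonneg _).trans (hM 0)
  set S : ℝ → Set (En n) := fun ε => {z | ε ≤ ‖z‖} with hS
  have hSm : ∀ ε, MeasurableSet (S ε) := fun ε =>
    measurableSet_le measurable_const measurable_norm
  have hSneg : ∀ ε z, -z ∈ S ε ↔ z ∈ S ε := fun ε z => by simp [hS]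
  have hcut : ∀ ε, 0 < ε → ∫ y in {y : En n | ε ≤ dist y x}, (v x - v y) * K (x - y)
      = (1 / 2) * ∫ z, (S ε).indicator (fun z => sdiff2 v x z * K z) z := by
    intro ε hε
    have hm : MeasurableSet {y : En n | ε ≤ dist y x} :=
      measurableSet_le measurable_const (measurable_id.dist measurable_const)
    rw [← integral_indicator hm, ← integral_sub_left_eq_self _ volume x]
    set P : En n → ℝ := (S ε).indicator fun z => (v x - v (x - z)) * K z with hP
    have h1 : (fun z => {y : En n | ε ≤ dist y x}.indicator
        (fun y => (v x - v y) * K (x - y)) (x - z)) = P := by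
      funext z
      simp [hP, hS, indicator, dist_eq_norm]
    rw [h1]
    have hPi : Integrable P := by
      have h2 : Integrable (fun z =>
          (S ε).indicator (fun z => v x - v (x - z)) z * K z) := by
        refine hK.integrable_mul hn hs hc₁ hε (C := 2 * M)
          ((by have := hv.continuous; fun_prop :
            Continuous fun z => v x - v (x - z)).aestronglyMeasurable.indicator (hSm ε)) ?_
        intro z _
        by_cases hz : z ∈ S ε
        · have h3 : (1:ℝ) ≤ ε⁻¹ * ‖z‖ := by
            rw [inv_mul_eq_div, one_le_div hε]; exact hz
          rw [indicator_of_mem hz, min_eq_right (by nlinarith)]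
          have h4 := abs_le.1 (hM x)
          have h5 := abs_le.1 (hM (x - z))
          rw [abs_le]
          constructor <;> linarith
        · rw [indicator_of_notMem hz]
          simp only [abs_zero]
          positivity
      refine h2.congr (Eventually.of_forall fun z => ?_)
      simp only [hP, indicator]
      split_ifs <;> simp
    have h6 : ∫ z, P z = (1 / 2) * ∫ z, (P z + P (-z)) := by
      rw [integral_add hPi hPi.comp_neg, integral_neg_eq_self P]
      ring
    rw [h6]
    congr 2
    funext z
    by_cases hz : z ∈ S ε
    · have hz0 : z ≠ 0 := by
        rintro rfl
        simp [hS] at hz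
        linarith
      simp only [hP]
      rw [indicator_of_mem hz, indicator_of_mem ((hSneg ε z).2 hz), indicator_of_mem hz,
        ← hK.even z hz0, sub_neg_eq_add]
      unfold sdiff2
      ring
    · simp only [hP]
      rw [indicator_of_notMem hz, indicator_of_notMem (mt (hSneg ε z).1 hz),
        indicator_of_notMem hz, add_zero]
  have hSu := hK.integrable_sdiff2_mul hn hs hc₁ hv hM x
  unfold opK pvAt symmOp
  refine Tendsto.limUnder_eq ?_
  have htend : Tendsto (fun ε => (1 / 2) * ∫ z, (S ε).indicator (fun z => sdiff2 v x z * K z) z)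
      (nhdsWithin (0:ℝ) (Ioi 0)) (nhds ((1 / 2) * ∫ z, sdiff2 v x z * K z)) := by
    refine Tendsto.const_mul _ ?_
    refine tendsto_integral_filter_of_dominated_convergence (fun z => ‖sdiff2 v x z * K z‖)
      (Eventually.of_forall fun ε => hSu.aestronglyMeasurable.indicator (hSm ε))
      (Eventually.of_forall fun ε => Eventually.of_forall fun z => norm_indicator_le_norm_self _ _)
      hSu.norm ?_
    filter_upwards [ae_ne_zero hn] with z hz
    refine tendsto_const_nhds.congr' ?_
    have : ∀ᶠ ε in nhdsWithin (0:ℝ) (Ioi 0), ε < ‖z‖ :=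
      nhdsWithin_le_nhds (Iio_mem_nhds (norm_pos_iff.2 hz))
    filter_upwards [this] with ε hε
    rw [indicator_of_mem (show z ∈ S ε from hε.le)]
  refine htend.congr' ?_
  filter_upwards [self_mem_nhdsWithin] with ε hε
  exact (hcut ε hε).symm

theorem hasDerivAt_symmOp (hK : BernsteinKernel n s c₁ c₂ c₃ K) (hn : 0 < n)
    (hs : s ∈ Ioo (0:ℝ) 1) (hc₁ : 0 ≤ c₁) {u : En n → ℝ} (hu : ContDiff ℝ 3 u) {M : ℝ}
    (hM : ∀ x, |u x| ≤ M) {M' : ℝ} (e : En n) (hM' : ∀ x, |dd n e u x| ≤ M') (x : En n) :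
    HasDerivAt (fun t : ℝ => symmOp K u (x + t • e)) (symmOp K (dd n e u) x) 0 := by
  have hv : ContDiff ℝ 2 (dd n e u) :=
    (hu.fderiv_right (m := 2) (by norm_num)).clm_apply contDiff_const
  have hud := hu.differentiable (by norm_num)
  obtain ⟨C, hC0, hC⟩ := exists_sdiff2_le hv hM' x
  have hx0 : x + (0:ℝ) • e = x := by simp
  have hd : ∀ (z : En n) (t : ℝ), HasDerivAt (fun t : ℝ => u (x + t • e + z))
      (dd n e u (x + t • e + z)) t := by
    intro z t
    have h1 : HasDerivAt (fun t : ℝ => x + t • e + z) e t := by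
      simpa using (((hasDerivAt_id t).smul_const e).const_add x).add_const z
    exact (hud _).hasFDerivAt.comp_hasDerivAt t h1
  have key := (hasDerivAt_integral_of_dominated_loc_of_deriv_le (μ := (volume : Measure (En n)))
    (F := fun (t : ℝ) z => sdiff2 u (x + t • e) z * K z)
    (F' := fun (t : ℝ) z => sdiff2 (dd n e u) (x + t • e) z * K z)
    (x₀ := (0:ℝ)) (s := ball 0 (‖e‖ + 1)⁻¹) (bound := fun z => C * c₂ * levyWeight n s 1 z)
    (ball_mem_nhds _ (by positivity))
    (Eventually.of_forall fun t =>
      (hK.integrable_sdiff2_mul hn hs hc₁ (hu.of_le (by norm_num)) hM _).aestronglyMeasurable)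
    (hK.integrable_sdiff2_mul hn hs hc₁ (hu.of_le (by norm_num)) hM _)
    (hK.integrable_sdiff2_mul hn hs hc₁ hv hM' _).aestronglyMeasurable
    ?_ ((integrable_levyWeight hn hs one_pos).const_mul _) ?_).2
  · simp only [hx0] at key
    exact key.const_mul _
  · filter_upwards [ae_ne_zero hn] with z hz t ht
    refine hK.norm_mul_le hc₁ hz (hC _ ?_ z)
    rw [mem_ball, dist_eq_norm, add_sub_cancel_left, norm_smul]
    rw [mem_ball, dist_zero_right] at ht
    calc ‖t‖ * ‖e‖ ≤ (‖e‖ + 1)⁻¹ * ‖e‖ := by gcongr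
      _ < 1 := by rw [inv_mul_eq_div, div_lt_one (by positivity)]; linarith
  · refine Eventually.of_forall fun z t _ => HasDerivAt.mul_const ?_ _
    have h0 := hd 0 t
    have h1 := hd z t
    have h2 := hd (-z) t
    simp only [add_zero, ← sub_eq_add_neg] at h0 h2
    exact ((h0.const_mul 2).sub h1).sub h2

end BernsteinKernel

/-- A smooth even bump equal to one on the ball of radius `r / 2` and supported in the ball of
radius `r`. -/
def cutoff (n : ℕ) (r : ℝ) (z : En n) : ℝ :=
  (⟨1 / 2, 1, by norm_num, by norm_num⟩ : ContDiffBump (0 : En n)) (r⁻¹ • z)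

section cutoff

variable {n : ℕ} {r : ℝ}

theorem cutoff_nonneg (z : En n) : 0 ≤ cutoff n r z := ContDiffBump.nonneg _

theorem cutoff_le_one (z : En n) : cutoff n r z ≤ 1 := ContDiffBump.le_one _

theorem cutoff_neg (z : En n) : cutoff n r (-z) = cutoff n r z := by
  unfold cutoff
  rw [smul_neg, ContDiffBump.neg]

theorem contDiff_cutoff : ContDiff ℝ 1 (cutoff n r) :=
  (ContDiffBump.contDiff _).comp (contDiff_const_smul _)

theorem cutoff_eq_one (hr : 0 < r) {z : En n} (hz : ‖z‖ ≤ r / 2) : cutoff n r z = 1 := by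
  refine ContDiffBump.one_of_mem_closedBall _ ?_
  rw [mem_closedBall, dist_zero_right, norm_smul, norm_inv, Real.norm_of_nonneg hr.le,
    inv_mul_le_iff₀ hr]
  simpa [div_eq_mul_inv] using hz

theorem cutoff_eq_zero (hr : 0 < r) {z : En n} (hz : r ≤ ‖z‖) : cutoff n r z = 0 := by
  refine ContDiffBump.zero_of_le_dist _ ?_
  rw [dist_zero_right, norm_smul, norm_inv, Real.norm_of_nonneg hr.le, le_inv_mul_iff₀ hr]
  simpa using hz

theorem fderiv_cutoff_eq_zero (hr : 0 < r) {z : En n} (hz : r < ‖z‖) :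
    fderiv ℝ (cutoff n r) z = 0 := by
  have h : cutoff n r =ᶠ[nhds z] fun _ => 0 := by
    filter_upwards [(isOpen_lt continuous_const continuous_norm).mem_nhds hz] with y hy
    exact cutoff_eq_zero hr (le_of_lt hy)
  rw [h.fderiv_eq]
  simp

theorem hasCompactSupport_cutoff (hr : 0 < r) : HasCompactSupport (cutoff n r) := by
  refine HasCompactSupport.of_support_subset_isCompact (isCompact_closedBall 0 r) ?_
  intro z hz
  rw [mem_closedBall, dist_zero_right]
  by_contra h
  exact hz (cutoff_eq_zero hr (not_le.1 h).le)

theorem integral_cutoff (hr : 0 < r) :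
    ∫ z, cutoff n r z = r ^ (n:ℝ) * ∫ z, cutoff n 1 z := by
  have h : ∀ z, cutoff n r z = cutoff n 1 (r⁻¹ • z) := fun z => by simp [cutoff]
  simp_rw [h]
  rw [Measure.integral_comp_inv_smul, abs_of_nonneg (by positivity), smul_eq_mul,
    finrank_euclideanSpace_fin, Real.rpow_natCast]

theorem integral_cutoff_one_pos (n : ℕ) : 0 < ∫ z, cutoff n 1 z := by
  unfold cutoff
  simp_rw [inv_one, one_smul]
  exact ContDiffBump.integral_pos _

theorem exists_norm_fderiv_cutoff_le (n : ℕ) :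
    ∃ M, 0 ≤ M ∧ ∀ r, 0 < r → ∀ z, ‖fderiv ℝ (cutoff n r) z‖ ≤ M * r⁻¹ := by
  obtain ⟨M, hM⟩ := (isCompact_closedBall (0 : En n) 1).exists_bound_of_continuousOn
    (f := fderiv ℝ (cutoff n 1)) (contDiff_cutoff.continuous_fderiv (by norm_num)).continuousOn
  have hM0 : 0 ≤ M := (norm_nonneg _).trans (hM 0 (mem_closedBall_self zero_le_one))
  refine ⟨M, hM0, fun r hr z => ?_⟩
  have h : cutoff n r = fun z => cutoff n 1 (r⁻¹ • z) := by funext z; simp [cutoff]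
  rw [h, fderiv_comp_smul, norm_smul, norm_inv, Real.norm_of_nonneg hr.le, mul_comm]
  gcongr
  rcases le_or_gt ‖r⁻¹ • z‖ 1 with h1 | h1
  · exact hM _ (by rwa [mem_closedBall, dist_zero_right])
  · rw [fderiv_cutoff_eq_zero one_pos h1, norm_zero]
    exact hM0

end cutoff

theorem integral_mul_dd_comp_add {n : ℕ} {f u : En n → ℝ} (e : En n) (hf : Differentiable ℝ f)
    (hfi : Integrable f) (hfi' : Integrable fun z => fderiv ℝ f z e) (hu : ContDiff ℝ 2 u) {M : ℝ}
    (hM : ∀ x, |u x| ≤ M) {M' : ℝ} (hM' : ∀ x, |dd n e u x| ≤ M') (x : En n) :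
    ∫ z, f z * dd n e u (x + z) = ∫ z, fderiv ℝ f z e * (u x - u (x + z)) := by
  have hud := hu.differentiable (by norm_num)
  have hvc : Continuous (dd n e u) :=
    ((hu.fderiv_right (m := 1) (by norm_num)).clm_apply contDiff_const).continuous
  have huc := hu.continuous
  have hg : ∀ z, fderiv ℝ (fun z => u (x + z) - u x) z e = dd n e u (x + z) := by
    intro z
    rw [fderiv_sub_const, fderiv_comp_add_left]
    rfl
  have hbd : ∀ z, |u (x + z) - u x| ≤ 2 * M := fun z => by
    have h4 := abs_le.1 (hM x)
    have h5 := abs_le.1 (hM (x + z))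
    rw [abs_le]
    constructor <;> linarith
  have h := integral_mul_fderiv_eq_neg_fderiv_mul_of_integrable (μ := (volume : Measure (En n)))
    (f := f) (g := fun z => u (x + z) - u x) (v := e) ?_ ?_ ?_ (fun z _ => hf z)
    (fun z _ => by fun_prop)
  · simp only [hg] at h
    rw [h, ← integral_neg]
    congr 1
    funext z
    ring
  · exact hfi'.mul_bdd (c := 2 * M) (by fun_prop) (Eventually.of_forall hbd)
  · simp only [hg]
    exact hfi.mul_bdd (c := M') (by fun_prop) (Eventually.of_forall fun z => hM' _)
  · exact hfi.mul_bdd (c := 2 * M) (by fun_prop) (Eventually.of_forall hbd)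

theorem integrable_cutoff_mul {n : ℕ} {r : ℝ} (hr : 0 < r) {h : En n → ℝ} (hh : Continuous h) :
    Integrable fun z => cutoff n r z * h z :=
  (contDiff_cutoff.continuous.mul hh).integrable_of_hasCompactSupport
    (hasCompactSupport_cutoff hr).mul_right

theorem abs_fderiv_apply_le {n : ℕ} (f : En n → ℝ) (z : En n) {e : En n} (he : ‖e‖ ≤ 1) :
    |fderiv ℝ f z e| ≤ ‖fderiv ℝ f z‖ := by
  have := (fderiv ℝ f z).le_opNorm e
  rw [Real.norm_eq_abs] at this
  nlinarith [norm_nonneg (fderiv ℝ f z)]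

namespace BernsteinKernel

variable {n : ℕ} {s c₁ c₂ c₃ : ℝ} {K : En n → ℝ}

theorem integrable_sub_sq_mul (hK : BernsteinKernel n s c₁ c₂ c₃ K) (hn : 0 < n)
    (hs : s ∈ Ioo (0:ℝ) 1) (hc₁ : 0 ≤ c₁) {v : En n → ℝ} (hv : ContDiff ℝ 1 v) {M : ℝ}
    (hM : ∀ x, |v x| ≤ M) (x : En n) : Integrable (fun z => (v x - v (x + z)) ^ 2 * K z) := by
  obtain ⟨C, -, hC⟩ := exists_sub_sq_le hv hM x
  have := hv.continuous
  exact hK.integrable_mul hn hs hc₁ one_pos (by fun_prop) fun z _ => hC z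

theorem integrable_cutoff_mul_sub_sq_mul (hK : BernsteinKernel n s c₁ c₂ c₃ K) (hn : 0 < n)
    (hs : s ∈ Ioo (0:ℝ) 1) (hc₁ : 0 ≤ c₁) {v : En n → ℝ} (hv : ContDiff ℝ 1 v) {M : ℝ}
    (hM : ∀ x, |v x| ≤ M) (x : En n) (r : ℝ) :
    Integrable (fun z => cutoff n r z * (v x - v (x + z)) ^ 2 * K z) := by
  obtain ⟨C, -, hC⟩ := exists_sub_sq_le hv hM x
  have := hv.continuous
  have := (contDiff_cutoff (n := n) (r := r)).continuous
  refine hK.integrable_mul hn hs hc₁ one_pos (by fun_prop) fun z _ => (le_trans ?_ (hC z))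
  rw [abs_mul, abs_of_nonneg (cutoff_nonneg z)]
  exact mul_le_of_le_one_left (abs_nonneg _) (cutoff_le_one z)

theorem one_le_mul (hK : BernsteinKernel n s c₁ c₂ c₃ K) (hs : s ∈ Ioo (0:ℝ) 1) (hc₁ : 0 < c₁)
    {r : ℝ} (hr : 0 < r) {z : En n} (hz : z ≠ 0) (hzr : ‖z‖ ≤ r) :
    1 ≤ r ^ ((n:ℝ) + 2 * s) / c₁ * K z := by
  have hz' := norm_pos_iff.2 hz
  have h1 : r ^ (-((n:ℝ) + 2 * s)) ≤ ‖z‖ ^ (-((n:ℝ) + 2 * s)) :=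
    Real.rpow_le_rpow_of_nonpos hz' hzr (by
      have h0 := hs.1
      have h1 : (0:ℝ) ≤ (n:ℝ) + 2 * s := by positivity
      linarith)
  have h2 := hK.lower z hz
  have h3 : r ^ ((n:ℝ) + 2 * s) * r ^ (-((n:ℝ) + 2 * s)) = 1 := by
    rw [← Real.rpow_add hr]; simp
  calc (1:ℝ) = r ^ ((n:ℝ) + 2 * s) / c₁ * (c₁ * r ^ (-((n:ℝ) + 2 * s))) := by
        field_simp; linarith
    _ ≤ r ^ ((n:ℝ) + 2 * s) / c₁ * (c₁ * ‖z‖ ^ (-((n:ℝ) + 2 * s))) := by gcongr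
    _ ≤ _ := by gcongr

end BernsteinKernel

/-- Nonlocal interpolation: the square of a directional derivative at a point is controlled by
the localized energy of that derivative and the energy of the function. -/
theorem exists_rpow_mul_dd_sq_le {n : ℕ} (hn : 0 < n) {s : ℝ} (hs : s ∈ Ioo (0:ℝ) 1) {c₁ : ℝ}
    (hc₁ : 0 < c₁) :
    ∃ A, 0 ≤ A ∧ ∀ (c₂ c₃ : ℝ) (K : En n → ℝ), BernsteinKernel n s c₁ c₂ c₃ K →
      ∀ (u : En n → ℝ) (M M' : ℝ) (e : En n), ContDiff ℝ 2 u → ‖e‖ ≤ 1 → (∀ x, |u x| ≤ M) →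
      (∀ x, |dd n e u x| ≤ M') → ∀ (x : En n) (r : ℝ), 0 < r →
      r ^ (2 - 2 * s) * dd n e u x ^ 2
        ≤ A * (r ^ 2 * (∫ z, cutoff n r z * (dd n e u x - dd n e u (x + z)) ^ 2 * K z)
          + ∫ z, (u x - u (x + z)) ^ 2 * K z) := by
  obtain ⟨D, hD0, hD⟩ := exists_norm_fderiv_cutoff_le n
  have hm := integral_cutoff_one_pos n
  set m := ∫ z, cutoff n 1 z
  set ω := volume.real (ball (0 : En n) 1) with hω
  have hω0 : 0 < ω := by
    rw [hω, measureReal_def]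
    exact ENNReal.toReal_pos (measure_ball_pos _ _ one_pos).ne' measure_ball_lt_top.ne
  refine ⟨2 / (m * c₁) + 2 * D ^ 2 * ω / (m ^ 2 * c₁), by positivity, ?_⟩
  intro c₂ c₃ K hK u M M' e hu he hM hM' x r hr
  have hv : ContDiff ℝ 1 (dd n e u) :=
    (hu.fderiv_right (m := 1) (by norm_num)).clm_apply contDiff_const
  have hvc := hv.continuous
  have huc := hu.continuous
  have hIv := hK.integrable_cutoff_mul_sub_sq_mul hn hs hc₁.le hv hM' x r
  have hIw := hK.integrable_sub_sq_mul hn hs hc₁.le (hu.of_le (by norm_num)) hM x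
  set v := dd n e u with hvdef
  set Iv := ∫ z, cutoff n r z * (v x - v (x + z)) ^ 2 * K z
  set Iw := ∫ z, (u x - u (x + z)) ^ 2 * K z
  have hIv0 : 0 ≤ Iv := integral_nonneg_of_ae (by
    filter_upwards [ae_ne_zero hn] with z hz
    exact mul_nonneg (mul_nonneg (cutoff_nonneg z) (sq_nonneg _)) (hK.nonneg hc₁.le hz))
  have hIw0 : 0 ≤ Iw := integral_nonneg_of_ae (by
    filter_upwards [ae_ne_zero hn] with z hz
    exact mul_nonneg (sq_nonneg _) (hK.nonneg hc₁.le hz))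
  set q := r ^ ((n:ℝ) + 2 * s) / c₁ with hq
  have hq0 : 0 < q := by positivity
  have hnear : ∫ z, cutoff n r z * (v x * (v x - v (x + z)))
      ≤ 1 / 4 * v x ^ 2 * (r ^ (n:ℝ) * m) + q * Iv := by
    rw [← integral_cutoff hr, ← integral_const_mul, ← integral_const_mul, ← integral_add]
    · refine integral_mono_ae (integrable_cutoff_mul hr (by fun_prop)) ?_ ?_
      · refine Integrable.add ?_ (hIv.const_mul q)
        simpa using (integrable_cutoff_mul (n := n) hr continuous_const (h := fun _ => 1)).const_mul
          (1 / 4 * v x ^ 2)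
      · filter_upwards [ae_ne_zero hn] with z hz
        have hχ := cutoff_nonneg (r := r) z
        rcases le_total ‖z‖ r with hzr | hzr
        · have h1 := hK.one_le_mul hs hc₁ hr hz hzr
          have h2 : v x * (v x - v (x + z)) ≤ 1 / 4 * v x ^ 2 + (v x - v (x + z)) ^ 2 := by
            nlinarith [sq_nonneg (1 / 2 * v x - (v x - v (x + z)))]
          calc _ ≤ cutoff n r z * (1 / 4 * v x ^ 2 + (v x - v (x + z)) ^ 2 * 1) := by
                rw [mul_one]; gcongr
            _ ≤ cutoff n r z * (1 / 4 * v x ^ 2 + (v x - v (x + z)) ^ 2 * (q * K z)) := by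
                gcongr
            _ = _ := by ring
        · simp [cutoff_eq_zero hr hzr]
    · simpa using (integrable_cutoff_mul (n := n) hr continuous_const (h := fun _ => 1)).const_mul
          (1 / 4 * v x ^ 2)
    · exact hIv.const_mul q
  have hDc : Continuous fun z => fderiv ℝ (cutoff n r) z e :=
    ((contDiff_cutoff.continuous_fderiv (by norm_num)).clm_apply continuous_const)
  have hDi : Integrable fun z => fderiv ℝ (cutoff n r) z e :=
    hDc.integrable_of_hasCompactSupport ((hasCompactSupport_cutoff hr).fderiv_apply ℝ e)
  have hibp := integral_mul_dd_comp_add e (contDiff_cutoff.differentiable (by norm_num))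
    (by simpa using integrable_cutoff_mul (n := n) hr continuous_const (h := fun _ => 1))
    hDi hu hM hM' x
  have hball : ∫ z, (closedBall (0 : En n) r).indicator (fun _ => (1:ℝ)) z = r ^ (n:ℝ) * ω := by
    rw [integral_indicator measurableSet_closedBall, integral_const, smul_eq_mul, mul_one,
      measureReal_restrict_apply_univ, measureReal_def, Measure.addHaar_closedBall _ _ hr.le,
      ENNReal.toReal_mul, ENNReal.toReal_ofReal (by positivity), finrank_euclideanSpace_fin,
      Real.rpow_natCast]
    rfl
  have hballi : Integrable ((closedBall (0 : En n) r).indicator (fun _ => (1:ℝ))) :=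
    (integrable_indicator_iff measurableSet_closedBall).2
      (integrableOn_const measure_closedBall_lt_top.ne)
  have hfar : v x * ∫ z, fderiv ℝ (cutoff n r) z e * (u x - u (x + z))
      ≤ m / (4 * ω) * v x ^ 2 * (r ^ (n:ℝ) * ω) + D ^ 2 * ω / (m * r ^ 2) * q * Iw := by
    rw [← hball, ← integral_const_mul, ← integral_const_mul, ← integral_const_mul, ← integral_add
      (hballi.const_mul _) (hIw.const_mul _)]
    refine integral_mono_ae ?_ ((hballi.const_mul _).add (hIw.const_mul _)) ?_
    · refine Integrable.const_mul (hDi.mul_bdd (c := 2 * M) (by fun_prop)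
        (Eventually.of_forall fun z => ?_)) _
      have h4 := abs_le.1 (hM x)
      have h5 := abs_le.1 (hM (x + z))
      rw [Real.norm_eq_abs, abs_le]
      constructor <;> linarith
    · filter_upwards [ae_ne_zero hn] with z hz
      rcases le_or_gt ‖z‖ r with hzr | hzr
      · have h1 := hK.one_le_mul hs hc₁ hr hz hzr
        rw [indicator_of_mem (by simpa using hzr)]
        have h2 : |fderiv ℝ (cutoff n r) z e| ≤ D * r⁻¹ :=
          (abs_fderiv_apply_le _ z he).trans (hD r hr z)
        set d := fderiv ℝ (cutoff n r) z e
        set w := u x - u (x + z)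
        have h3 : d ^ 2 ≤ (D * r⁻¹) ^ 2 := by
          rw [← sq_abs d]
          exact pow_le_pow_left₀ (abs_nonneg _) h2 2
        have h4 : v x * (d * w) ≤ m / (4 * ω) * v x ^ 2 + ω / m * (d ^ 2 * w ^ 2) := by
          have : m / (4 * ω) * v x ^ 2 + ω / m * (d ^ 2 * w ^ 2) - v x * (d * w)
              = m / (4 * ω) * (v x - 2 * ω / m * (d * w)) ^ 2 := by
            field_simp; ring
          have h5 : 0 ≤ m / (4 * ω) * (v x - 2 * ω / m * (d * w)) ^ 2 := by positivity
          linarith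
        calc _ ≤ m / (4 * ω) * v x ^ 2 + ω / m * (d ^ 2 * (w ^ 2 * 1)) := by rwa [mul_one]
          _ ≤ m / (4 * ω) * v x ^ 2 + ω / m * ((D * r⁻¹) ^ 2 * (w ^ 2 * (q * K z))) := by
            gcongr
          _ = _ := by field_simp
      · rw [fderiv_cutoff_eq_zero hr hzr, indicator_of_notMem (by simpa using hzr)]
        have := hK.nonneg hc₁.le hz
        simp only [zero_apply, zero_mul, mul_zero, zero_add]
        positivity
  have hsplit : v x ^ 2 * (r ^ (n:ℝ) * m)
      = (∫ z, cutoff n r z * (v x * (v x - v (x + z))))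
        + v x * ∫ z, cutoff n r z * v (x + z) := by
    rw [← integral_cutoff hr, ← integral_const_mul, ← integral_const_mul, ← integral_add
      (integrable_cutoff_mul hr (by fun_prop))
      ((integrable_cutoff_mul hr (by fun_prop)).const_mul _)]
    congr 1
    funext z
    ring
  rw [hibp] at hsplit
  have hmain : v x ^ 2 * (r ^ (n:ℝ) * m)
      ≤ 2 * q * Iv + 2 * (D ^ 2 * ω / (m * r ^ 2) * q * Iw) := by
    have h1 : m / (4 * ω) * v x ^ 2 * (r ^ (n:ℝ) * ω) = 1 / 4 * v x ^ 2 * (r ^ (n:ℝ) * m) := by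
      field_simp
    linarith
  have hpow : r ^ ((n:ℝ) + 2 * s) = r ^ (n:ℝ) * r ^ (2 * s) := Real.rpow_add hr _ _
  have hpow2 : r ^ (2 - 2 * s) * r ^ (2 * s) = r ^ 2 := by
    rw [← Real.rpow_add hr]
    norm_num
  have hrn : 0 < r ^ (n:ℝ) := Real.rpow_pos_of_pos hr _
  have hrs : 0 < r ^ (2 * s) := Real.rpow_pos_of_pos hr _
  have hr2 : r ^ (2 - 2 * s) = r ^ 2 / r ^ (2 * s) := by rw [eq_div_iff hrs.ne', hpow2]
  rw [hr2]
  have hfinal : r ^ 2 / r ^ (2 * s) * v x ^ 2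
      ≤ 2 / (m * c₁) * r ^ 2 * Iv + 2 * D ^ 2 * ω / (m ^ 2 * c₁) * Iw := by
    have h1 : r ^ 2 / r ^ (2 * s) * v x ^ 2
        = r ^ 2 / (r ^ (2 * s) * r ^ (n:ℝ) * m) * (v x ^ 2 * (r ^ (n:ℝ) * m)) := by
      field_simp
    rw [h1]
    refine (mul_le_mul_of_nonneg_left hmain (by positivity)).trans (le_of_eq ?_)
    rw [hq, hpow]
    field_simp
  refine hfinal.trans ?_
  have e1 : 0 ≤ 2 * D ^ 2 * ω / (m ^ 2 * c₁) * (r ^ 2 * Iv) := by positivity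
  have e2 : 0 ≤ 2 / (m * c₁) * Iw := by positivity
  nlinarith

theorem one_sub_cutoff_le {n : ℕ} {r : ℝ} (hr : 0 < r) (z : En n) :
    1 - cutoff n r z ≤ 4 * min ((r⁻¹ * ‖z‖) ^ 2) 1 := by
  rcases le_total ‖z‖ (r / 2) with h | h
  · rw [cutoff_eq_one hr h, sub_self]
    positivity
  · have h1 : 1 / 2 ≤ r⁻¹ * ‖z‖ := by
      rw [inv_mul_eq_div, le_div_iff₀ hr]
      linarith
    have h2 : 1 / 4 ≤ min ((r⁻¹ * ‖z‖) ^ 2) 1 := le_min (by nlinarith) (by norm_num)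
    linarith [cutoff_nonneg (r := r) z]

namespace BernsteinKernel

variable {n : ℕ} {s c₁ c₂ c₃ : ℝ} {K : En n → ℝ}

theorem integrable_one_sub_cutoff_mul (hK : BernsteinKernel n s c₁ c₂ c₃ K) (hn : 0 < n)
    (hs : s ∈ Ioo (0:ℝ) 1) (hc₁ : 0 ≤ c₁) {r : ℝ} (hr : 0 < r) :
    Integrable (fun z => (1 - cutoff n r z) * K z) := by
  have := (contDiff_cutoff (n := n) (r := r)).continuous
  refine hK.integrable_mul hn hs hc₁ hr (C := 4) (by fun_prop) fun z _ => ?_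
  rw [abs_of_nonneg (by linarith [cutoff_le_one (r := r) z])]
  exact one_sub_cutoff_le hr z

theorem eventuallyEq_zero_one_sub_cutoff_mul {r : ℝ} (hr : 0 < r) {z : En n} (hz : ‖z‖ < r / 2) :
    (fun z => (1 - cutoff n r z) * K z) =ᶠ[nhds z] fun _ => 0 := by
  filter_upwards [(isOpen_lt continuous_norm continuous_const).mem_nhds hz] with y hy
  rw [cutoff_eq_one hr (le_of_lt hy)]
  simp

theorem differentiable_one_sub_cutoff_mul (hK : BernsteinKernel n s c₁ c₂ c₃ K) {r : ℝ}
    (hr : 0 < r) : Differentiable ℝ (fun z => (1 - cutoff n r z) * K z) := by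
  intro z
  rcases lt_or_ge ‖z‖ (r / 2) with hz | hz
  · exact (differentiableAt_const 0).congr_of_eventuallyEq
      (eventuallyEq_zero_one_sub_cutoff_mul hr hz)
  · have hz0 : z ≠ 0 := norm_pos_iff.1 (by linarith)
    exact ((contDiff_cutoff.differentiable (by norm_num) z).const_sub 1).mul (hK.diff z hz0)

theorem abs_fderiv_one_sub_cutoff_mul_le (hK : BernsteinKernel n s c₁ c₂ c₃ K) (hc₁ : 0 ≤ c₁)
    (hc₃ : 0 ≤ c₃) {D : ℝ} {r : ℝ} (hr : 0 < r)
    (hD : ∀ z, ‖fderiv ℝ (cutoff n r) z‖ ≤ D * r⁻¹) {e : En n} (he : ‖e‖ ≤ 1) {z : En n}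
    (hz : r / 2 ≤ ‖z‖) :
    |fderiv ℝ (fun z => (1 - cutoff n r z) * K z) z e| ≤ (D + 2 * c₃) * r⁻¹ * K z := by
  have hzp : 0 < ‖z‖ := by linarith
  have hz0 : z ≠ 0 := norm_pos_iff.1 hzp
  have hK0 := hK.nonneg hc₁ hz0
  have hcd := contDiff_cutoff.differentiable (by norm_num) (x := z) (f := cutoff n r)
  have h1 : fderiv ℝ (fun z => (1 - cutoff n r z) * K z) z e
      = (1 - cutoff n r z) * fderiv ℝ K z e - K z * fderiv ℝ (cutoff n r) z e := by
    rw [fderiv_fun_mul (hcd.const_sub 1) (hK.diff z hz0), fderiv_const_sub]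
    simp [sub_eq_add_neg]
  have h2 : |fderiv ℝ (cutoff n r) z e| ≤ D * r⁻¹ := (abs_fderiv_apply_le _ z he).trans (hD z)
  have h3 : |fderiv ℝ K z e| ≤ 2 * c₃ * r⁻¹ * K z := by
    refine (abs_fderiv_apply_le _ z he).trans ?_
    have h4 : ‖fderiv ℝ K z‖ ≤ c₃ * K z / ‖z‖ := by
      rw [le_div_iff₀ hzp, mul_comm]
      exact hK.deriv_le z hz0
    refine h4.trans ?_
    rw [div_le_iff₀ hzp]
    have h5 : 1 ≤ 2 * r⁻¹ * ‖z‖ := by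
      rw [mul_assoc, inv_mul_eq_div, ← mul_div_assoc, one_le_div hr]
      linarith
    have h6 : 0 ≤ c₃ * K z := by positivity
    nlinarith
  have h7 := cutoff_nonneg (r := r) z
  have h8 := cutoff_le_one (r := r) z
  rw [h1]
  calc _ ≤ |(1 - cutoff n r z) * fderiv ℝ K z e| + |K z * fderiv ℝ (cutoff n r) z e| :=
        abs_sub _ _
    _ ≤ 1 * (2 * c₃ * r⁻¹ * K z) + K z * (D * r⁻¹) := by
        rw [abs_mul, abs_mul, abs_of_nonneg hK0, abs_of_nonneg (by linarith : 0 ≤ 1 - cutoff n r z)]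
        gcongr
        linarith
    _ = _ := by ring

end BernsteinKernel

/-- Integration by parts bounds the contribution of the derivative away from the centre. -/
theorem exists_dd_mul_integral_far_le {n : ℕ} (hn : 0 < n) {s : ℝ} (hs : s ∈ Ioo (0:ℝ) 1)
    {c₁ c₂ c₃ : ℝ} (hc₁ : 0 ≤ c₁) (hc₂ : 0 ≤ c₂) (hc₃ : 0 ≤ c₃) :
    ∃ D, 0 ≤ D ∧ ∀ K : En n → ℝ, BernsteinKernel n s c₁ c₂ c₃ K →
      ∀ (u : En n → ℝ) (M M' : ℝ) (e : En n), ContDiff ℝ 2 u → ‖e‖ ≤ 1 → (∀ x, |u x| ≤ M) →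
      (∀ x, |dd n e u x| ≤ M') → ∀ (x : En n) (r σ : ℝ), 0 < r → 0 < σ →
      dd n e u x * (∫ z, (1 - cutoff n r z) * K z * dd n e u (x + z))
        ≤ σ / r ^ 2 * (∫ z, (u x - u (x + z)) ^ 2 * K z)
          + D / σ * (r ^ (-(2 * s)) * dd n e u x ^ 2) := by
  obtain ⟨D, hD0, hD⟩ := exists_norm_fderiv_cutoff_le n
  have hG0 : 0 ≤ ∫ z : En n, levyWeight n s 1 z :=
    integral_nonneg fun z => levyWeight_nonneg n s 1 z
  refine ⟨(D + 2 * c₃) ^ 2 * (c₂ * ∫ z, levyWeight n s 1 z), by positivity, ?_⟩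
  intro K hK u M M' e hu he hM hM' x r σ hr hσ
  have hvc : Continuous (dd n e u) :=
    ((hu.fderiv_right (m := 1) (by norm_num)).clm_apply contDiff_const).continuous
  have huc := hu.continuous
  have hIw := hK.integrable_sub_sq_mul hn hs hc₁ (hu.of_le (by norm_num)) hM x
  have hpi : Integrable (fun z : En n => min ((r⁻¹ * ‖z‖) ^ 2) 1 * K z) :=
    hK.integrable_mul hn hs hc₁ hr (C := 1) (by fun_prop) fun z _ => by
      rw [abs_of_nonneg (by positivity), one_mul]
  have hple : ∫ z : En n, min ((r⁻¹ * ‖z‖) ^ 2) 1 * K z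
      ≤ 1 * c₂ * (r ^ (-(2*s)) * ∫ z, levyWeight n s 1 z) :=
    hK.integral_mul_le hn hs hc₁ hr (by fun_prop) fun z _ => by
      rw [abs_of_nonneg (by positivity), one_mul]
  have hι : ∀ z : En n, r / 2 ≤ ‖z‖ → 1 ≤ 4 * min ((r⁻¹ * ‖z‖) ^ 2) 1 := by
    intro z hz
    have h1 : 1 / 2 ≤ r⁻¹ * ‖z‖ := by
      rw [inv_mul_eq_div, le_div_iff₀ hr]
      linarith
    have h2 : 1 / 4 ≤ min ((r⁻¹ * ‖z‖) ^ 2) 1 := le_min (by nlinarith) (by norm_num)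
    linarith
  have hGzero : ∀ z : En n, ‖z‖ < r / 2 →
      fderiv ℝ (fun z => (1 - cutoff n r z) * K z) z = 0 := by
    intro z hz
    rw [(BernsteinKernel.eventuallyEq_zero_one_sub_cutoff_mul hr hz).fderiv_eq]
    simp
  have hGi : Integrable fun z => fderiv ℝ (fun z => (1 - cutoff n r z) * K z) z e := by
    refine (hpi.const_mul ((D + 2 * c₃) * r⁻¹ * 4)).mono'
      (measurable_fderiv_apply_const ℝ _ e).aestronglyMeasurable ?_
    filter_upwards [ae_ne_zero hn] with z hz
    have hK0 := hK.nonneg hc₁ hz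
    rcases lt_or_ge ‖z‖ (r / 2) with hzr | hzr
    · rw [hGzero z hzr]
      simp only [zero_apply, norm_zero]
      positivity
    · refine (hK.abs_fderiv_one_sub_cutoff_mul_le hc₁ hc₃ hr (hD r hr) he hzr).trans ?_
      have := hι z hzr
      have h2 : 0 ≤ (D + 2 * c₃) * r⁻¹ * K z := by positivity
      nlinarith
  rw [integral_mul_dd_comp_add e (hK.differentiable_one_sub_cutoff_mul hr)
    (hK.integrable_one_sub_cutoff_mul hn hs hc₁ hr) hGi hu hM hM' x]
  set v := dd n e u x
  set L := D + 2 * c₃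
  calc v * ∫ z, fderiv ℝ (fun z => (1 - cutoff n r z) * K z) z e * (u x - u (x + z))
      ≤ σ / r ^ 2 * (∫ z, (u x - u (x + z)) ^ 2 * K z)
        + L ^ 2 / σ * v ^ 2 * ∫ z : En n, min ((r⁻¹ * ‖z‖) ^ 2) 1 * K z := by
        rw [← integral_const_mul, ← integral_const_mul, ← integral_const_mul, ← integral_add
          (hIw.const_mul _) (hpi.const_mul _)]
        refine integral_mono_ae ?_ ((hIw.const_mul _).add (hpi.const_mul _)) ?_
        · refine Integrable.const_mul (hGi.mul_bdd (c := 2 * M) (by fun_prop)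
            (Eventually.of_forall fun z => ?_)) _
          have h4 := abs_le.1 (hM x)
          have h5 := abs_le.1 (hM (x + z))
          rw [Real.norm_eq_abs, abs_le]
          constructor <;> linarith
        · filter_upwards [ae_ne_zero hn] with z hz
          have hK0 := hK.nonneg hc₁ hz
          rcases lt_or_ge ‖z‖ (r / 2) with hzr | hzr
          · rw [hGzero z hzr]
            simp only [zero_apply, zero_mul, mul_zero]
            positivity
          · have h1 := hK.abs_fderiv_one_sub_cutoff_mul_le hc₁ hc₃ hr (hD r hr) he hzr
            have h2 := hι z hzr
            set d := fderiv ℝ (fun z => (1 - cutoff n r z) * K z) z e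
            set w := u x - u (x + z)
            set p := min ((r⁻¹ * ‖z‖) ^ 2) 1
            calc v * (d * w) ≤ |v * (d * w)| := le_abs_self _
              _ = |d| * (|v| * |w|) := by rw [abs_mul, abs_mul]; ring
              _ ≤ L * r⁻¹ * K z * (|v| * |w|) := by gcongr
              _ = (L * r⁻¹ * |v| * |w|) * K z := by ring
              _ ≤ (σ / r ^ 2 * w ^ 2 + L ^ 2 / (4 * σ) * v ^ 2 * 1) * K z := by
                gcongr
                rw [← sq_abs w, ← sq_abs v]
                have h3 : σ / r ^ 2 * |w| ^ 2 + L ^ 2 / (4 * σ) * |v| ^ 2 * 1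
                    - L * r⁻¹ * |v| * |w|
                    = σ / r ^ 2 * (|w| - r * L / (2 * σ) * |v|) ^ 2 := by
                  field_simp; ring
                have h4 : 0 ≤ σ / r ^ 2 * (|w| - r * L / (2 * σ) * |v|) ^ 2 := by positivity
                linarith
              _ ≤ (σ / r ^ 2 * w ^ 2 + L ^ 2 / (4 * σ) * v ^ 2 * (4 * p)) * K z := by gcongr
              _ = _ := by field_simp
    _ ≤ σ / r ^ 2 * (∫ z, (u x - u (x + z)) ^ 2 * K z)
        + L ^ 2 / σ * v ^ 2 * (1 * c₂ * (r ^ (-(2*s)) * ∫ z, levyWeight n s 1 z)) := by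
        gcongr
    _ = _ := by ring

/-- The quadratic cutoff `(1 - ‖y‖² / R²)₊`. -/
def quadCutoff {n : ℕ} (R : ℝ) (y : En n) : ℝ := max (1 - (‖y‖ / R) ^ 2) 0

theorem quadCutoff_nonneg {n : ℕ} (R : ℝ) (y : En n) : 0 ≤ quadCutoff R y := le_max_right _ _

theorem quadCutoff_le_one {n : ℕ} (R : ℝ) (y : En n) : quadCutoff R y ≤ 1 :=
  max_le (by linarith [sq_nonneg (‖y‖ / R)]) zero_le_one

theorem continuous_quadCutoff {n : ℕ} (R : ℝ) : Continuous (quadCutoff (n := n) R) := by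
  unfold quadCutoff
  fun_prop

theorem quadCutoff_eq_zero {n : ℕ} {R : ℝ} (hR : 0 < R) {y : En n} (hy : R ≤ ‖y‖) :
    quadCutoff R y = 0 := by
  refine max_eq_right ?_
  have : 1 ≤ ‖y‖ / R := (one_le_div hR).2 hy
  nlinarith

theorem near_pointwise_le {h ρ c v v₁ v₂ : ℝ} (hh : 0 < h) (hh1 : h ≤ 1) (hρ : 0 ≤ ρ)
    (hρh : ρ ≤ h / 6) (hc : |c| ≤ 2 * ρ) :
    (h ^ 2 * (-v ^ 2 + 2 * v * v₁) - (h - ρ ^ 2 - c) ^ 2 * v₁ ^ 2)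
      + (h ^ 2 * (-v ^ 2 + 2 * v * v₂) - (h - ρ ^ 2 + c) ^ 2 * v₂ ^ 2)
      ≤ 600 * v ^ 2 * ρ ^ 2 - h ^ 2 / 8 * ((v - v₁) ^ 2 + (v - v₂) ^ 2) := by
  have one : ∀ c' v', |c'| ≤ 2 * ρ →
      h ^ 2 * (-v ^ 2 + 2 * v * v') - (h - ρ ^ 2 - c') ^ 2 * v' ^ 2
        ≤ v ^ 2 * (h ^ 2 - (h - ρ ^ 2 - c') ^ 2) + 288 * ρ ^ 2 * v ^ 2
          - h ^ 2 / 8 * (v - v') ^ 2 := by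
    intro c' v' hc'
    obtain ⟨hc1, hc2⟩ := abs_le.1 hc'
    have hρ2 : ρ ^ 2 ≤ ρ / 6 := by nlinarith
    set k := h - ρ ^ 2 - c' with hk
    have hk1 : h / 2 ≤ k := by nlinarith
    have hk2 : k ≤ 3 / 2 * h := by nlinarith
    have hk3 : |h ^ 2 - k ^ 2| ≤ 6 * ρ * h := by
      have e1 : h ^ 2 - k ^ 2 = (h - k) * (h + k) := by ring
      have e2 : |h - k| ≤ 13 / 6 * ρ := by
        rw [abs_le]; constructor <;> nlinarith [sq_nonneg ρ]
      rw [e1, abs_mul, abs_of_nonneg (by linarith : 0 ≤ h + k)]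
      calc |h - k| * (h + k) ≤ 13 / 6 * ρ * (5 / 2 * h) :=
            mul_le_mul e2 (by linarith) (by linarith) (by positivity)
        _ ≤ 6 * ρ * h := by nlinarith [mul_nonneg hρ hh.le]
    have e3 : h ^ 2 * (-v ^ 2 + 2 * v * v') - k ^ 2 * v' ^ 2
        = v ^ 2 * (h ^ 2 - k ^ 2) - 2 * v * (v - v') * (h ^ 2 - k ^ 2) - k ^ 2 * (v - v') ^ 2 := by
      ring
    rw [e3]
    have e4 : -(2 * v * (v - v') * (h ^ 2 - k ^ 2))
        ≤ 288 * ρ ^ 2 * v ^ 2 + h ^ 2 / 8 * (v - v') ^ 2 := by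
      calc -(2 * v * (v - v') * (h ^ 2 - k ^ 2)) ≤ |2 * v * (v - v') * (h ^ 2 - k ^ 2)| :=
            neg_le_abs _
        _ = 2 * (|v| * |v - v'|) * |h ^ 2 - k ^ 2| := by
            rw [abs_mul, abs_mul, abs_mul, abs_two]; ring
        _ ≤ 2 * (|v| * |v - v'|) * (6 * ρ * h) := by gcongr
        _ ≤ 288 * ρ ^ 2 * v ^ 2 + h ^ 2 / 8 * (v - v') ^ 2 := by
            rw [← sq_abs v, ← sq_abs (v - v')]
            nlinarith [sq_nonneg (48 * ρ * |v| - h * |v - v'|)]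
    have e5 : h ^ 2 / 4 * (v - v') ^ 2 ≤ k ^ 2 * (v - v') ^ 2 := by
      gcongr
      nlinarith
    linarith
  have h1 := one c v₁ hc
  have h2 := one (-c) v₂ (by rwa [abs_neg])
  rw [sub_neg_eq_add] at h2
  have h3 : (h ^ 2 - (h - ρ ^ 2 - c) ^ 2) + (h ^ 2 - (h - ρ ^ 2 + c) ^ 2) ≤ 4 * ρ ^ 2 := by
    nlinarith [sq_nonneg c, sq_nonneg (ρ ^ 2), mul_nonneg (sub_nonneg.2 hh1) (sq_nonneg ρ)]
  have h4 := mul_le_mul_of_nonneg_left h3 (sq_nonneg v)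
  nlinarith [mul_nonneg (sq_nonneg v) (sq_nonneg ρ)]

theorem quadCutoff_pointwise_le {n : ℕ} {R r : ℝ} (hR : 0 < R) {x z : En n}
    (hx : 0 < quadCutoff R x) (hr : 0 < r) (hrR : r ≤ quadCutoff R x / 6 * R) (v v₁ v₂ : ℝ) :
    (quadCutoff R x ^ 2 * (-v ^ 2 + 2 * v * v₁) - quadCutoff R (x + z) ^ 2 * v₁ ^ 2)
      + (quadCutoff R x ^ 2 * (-v ^ 2 + 2 * v * v₂) - quadCutoff R (x - z) ^ 2 * v₂ ^ 2)
      ≤ cutoff n r z * (600 * v ^ 2 * (‖z‖ / R) ^ 2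
          - quadCutoff R x ^ 2 / 8 * ((v - v₁) ^ 2 + (v - v₂) ^ 2))
        + 2 * quadCutoff R x ^ 2 * v * (1 - cutoff n r z) * (v₁ + v₂) := by
  set h := quadCutoff R x with hh
  have hχ0 := cutoff_nonneg (r := r) z
  have hχ1 := cutoff_le_one (r := r) z
  set E := (h ^ 2 * (-v ^ 2 + 2 * v * v₁) - quadCutoff R (x + z) ^ 2 * v₁ ^ 2)
      + (h ^ 2 * (-v ^ 2 + 2 * v * v₂) - quadCutoff R (x - z) ^ 2 * v₂ ^ 2) with hE
  have hfar : E ≤ 2 * h ^ 2 * v * (v₁ + v₂) := by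
    have h1 : 0 ≤ quadCutoff R (x + z) ^ 2 * v₁ ^ 2 := by positivity
    have h2 : 0 ≤ quadCutoff R (x - z) ^ 2 * v₂ ^ 2 := by positivity
    have h3 : 0 ≤ h ^ 2 * v ^ 2 := by positivity
    rw [hE]
    linarith
  have hnear : cutoff n r z * E ≤ cutoff n r z * (600 * v ^ 2 * (‖z‖ / R) ^ 2
          - h ^ 2 / 8 * ((v - v₁) ^ 2 + (v - v₂) ^ 2)) := by
    rcases le_total r ‖z‖ with hz | hz
    · simp [cutoff_eq_zero hr hz]
    · refine mul_le_mul_of_nonneg_left ?_ hχ0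
      have hxe : h = 1 - (‖x‖ / R) ^ 2 := by
        rw [hh]
        refine max_eq_left ?_
        by_contra hcon
        rw [hh, quadCutoff, max_eq_right (not_le.1 hcon).le] at hx
        exact lt_irrefl _ hx
      set ρ := ‖z‖ / R with hρ
      have hρ0 : 0 ≤ ρ := by positivity
      have hρh : ρ ≤ h / 6 := by
        rw [hρ, div_le_iff₀ hR]
        exact hz.trans hrR
      have hh1 : h ≤ 1 := quadCutoff_le_one R x
      have hxR : ‖x‖ / R ≤ 1 := by
        by_contra hcon
        nlinarith [not_le.1 hcon]
      set c := 2 * inner ℝ x z / R ^ 2 with hc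
      have hcle : |c| ≤ 2 * ρ := by
        rw [hc, abs_div, abs_mul, abs_two, abs_of_pos (by positivity : 0 < R ^ 2)]
        have h1 := abs_real_inner_le_norm x z
        calc 2 * |inner ℝ x z| / R ^ 2 ≤ 2 * (‖x‖ * ‖z‖) / R ^ 2 := by gcongr
          _ = 2 * (‖x‖ / R * ρ) := by rw [hρ]; field_simp
          _ ≤ 2 * (1 * ρ) := by gcongr
          _ = _ := by ring
      obtain ⟨hc1, hc2⟩ := abs_le.1 hcle
      have hp : quadCutoff R (x + z) = h - ρ ^ 2 - c := by
        have h1 : 1 - (‖x + z‖ / R) ^ 2 = h - ρ ^ 2 - c := by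
          rw [div_pow, norm_add_sq_real, hxe, hρ, hc]
          field_simp
          ring
        rw [quadCutoff, h1]
        exact max_eq_left (by nlinarith)
      have hm : quadCutoff R (x - z) = h - ρ ^ 2 + c := by
        have h1 : 1 - (‖x - z‖ / R) ^ 2 = h - ρ ^ 2 + c := by
          rw [div_pow, norm_sub_sq_real, hxe, hρ, hc]
          field_simp
          ring
        rw [quadCutoff, h1]
        exact max_eq_left (by nlinarith)
      rw [hE, hp, hm]
      exact near_pointwise_le hx hh1 hρ0 hρh hcle
  have h5 := mul_le_mul_of_nonneg_left hfar (sub_nonneg.2 hχ1)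
  nlinarith

theorem sdiff2_le_of_max {h h₁ h₂ v v₁ v₂ u u₁ u₂ t a X : ℝ}
    (hX : (h ^ 2 * (-v ^ 2 + 2 * v * v₁) - h₁ ^ 2 * v₁ ^ 2)
      + (h ^ 2 * (-v ^ 2 + 2 * v * v₂) - h₂ ^ 2 * v₂ ^ 2) ≤ X)
    (h1 : h₁ ^ 2 * v₁ ^ 2 + t * (u₁ - a) ^ 2 ≤ h ^ 2 * v ^ 2 + t * (u - a) ^ 2)
    (h2 : h₂ ^ 2 * v₂ ^ 2 + t * (u₂ - a) ^ 2 ≤ h ^ 2 * v ^ 2 + t * (u - a) ^ 2) :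
    0 ≤ 2 * h ^ 2 * v * (2 * v - v₁ - v₂) + 2 * t * (u - a) * (2 * u - u₁ - u₂)
      - t * ((u - u₁) ^ 2 + (u - u₂) ^ 2) + X := by
  linarith

theorem integral_add_sub_add_sub_add {X : Type*} [MeasurableSpace X] {μ : Measure X}
    {f₁ f₂ f₃ f₄ f₅ f₆ : X → ℝ} (h₁ : Integrable f₁ μ) (h₂ : Integrable f₂ μ)
    (h₃ : Integrable f₃ μ) (h₄ : Integrable f₄ μ) (h₅ : Integrable f₅ μ) (h₆ : Integrable f₆ μ) :
    ∫ z, (f₁ z + f₂ z - f₃ z + f₄ z - f₅ z + f₆ z) ∂μ = ∫ z, f₁ z ∂μ + ∫ z, f₂ z ∂μ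
      - ∫ z, f₃ z ∂μ + ∫ z, f₄ z ∂μ - ∫ z, f₅ z ∂μ + ∫ z, f₆ z ∂μ := by
  have e₁ := integral_add h₁ h₂
  have e₂ := integral_sub (h₁.add h₂) h₃
  have e₃ := integral_add ((h₁.add h₂).sub h₃) h₄
  have e₄ := integral_sub (((h₁.add h₂).sub h₃).add h₄) h₅
  have e₅ := integral_add ((((h₁.add h₂).sub h₃).add h₄).sub h₅) h₆
  simp only [Pi.add_apply, Pi.sub_apply] at e₁ e₂ e₃ e₄ e₅
  rw [e₅, e₄, e₃, e₂, e₁]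

set_option maxHeartbeats 1000000 in
/-- The Bernstein inequality at a global maximum of `η² (∂_e u)² + τ R⁻² (u - a)²`. -/
theorem exists_bernstein_at_max {n : ℕ} (hn : 0 < n) {s : ℝ} (hs : s ∈ Ioo (0:ℝ) 1)
    {c₁ c₂ c₃ : ℝ} (hc₁ : 0 < c₁) (hc₂ : 0 ≤ c₂) (hc₃ : 0 ≤ c₃) :
    ∃ τ ε : ℝ, 0 < τ ∧ 0 < ε ∧ ∀ K : En n → ℝ, BernsteinKernel n s c₁ c₂ c₃ K →
      ∀ (u : En n → ℝ) (M M' : ℝ) (e : En n), ContDiff ℝ 3 u → ‖e‖ ≤ 1 → (∀ x, |u x| ≤ M) →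
      (∀ x, |dd n e u x| ≤ M') → ∀ (R a : ℝ) (x : En n), 0 < R → 0 < quadCutoff R x →
      (∀ y, quadCutoff R y ^ 2 * dd n e u y ^ 2 + τ / R ^ 2 * (u y - a) ^ 2
        ≤ quadCutoff R x ^ 2 * dd n e u x ^ 2 + τ / R ^ 2 * (u x - a) ^ 2) →
      (ε * quadCutoff R x * R) ^ (2 - 2 * s) * dd n e u x ^ 2 / R ^ 2
        ≤ 4 * (quadCutoff R x ^ 2 * dd n e u x * symmOp K (dd n e u) x
          + τ / R ^ 2 * (u x - a) * symmOp K u x) := by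
  obtain ⟨A, hA0, hA⟩ := exists_rpow_mul_dd_sq_le hn hs hc₁
  obtain ⟨D, hD0, hD⟩ := exists_dd_mul_integral_far_le hn hs hc₁.le hc₂ hc₃
  set G := ∫ z : En n, levyWeight n s 1 z
  have hG0 : 0 ≤ G := integral_nonneg fun z => levyWeight_nonneg n s 1 z
  set E := 600 * (c₂ * G) + 4 * D + 1 with hE
  have hE1 : 1 ≤ E := by
    have : 0 ≤ c₂ * G := by positivity
    linarith
  set ε := min (1 / 6) (1 / (4 * (E * A + 1))) with hε
  have hEA : 0 ≤ E * A := by positivity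
  have hε0 : 0 < ε := lt_min (by norm_num) (by positivity)
  have hε6 : ε ≤ 1 / 6 := min_le_left _ _
  have hεA : E * A * ε ^ 2 ≤ 1 / 4 := by
    have h1 : ε ≤ 1 / (4 * (E * A + 1)) := min_le_right _ _
    have h2 : (E * A + 1) * ε ≤ 1 / 4 := by
      rw [le_div_iff₀ (by positivity)] at h1
      linarith
    nlinarith
  set τ := E * A + 4 / ε ^ 4 with hτ
  have hτ0 : 0 < τ := by positivity
  refine ⟨τ, ε, hτ0, hε0, ?_⟩
  intro K hK u M M' e hu he hM hM' R a x hR hx hmax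
  have hv : ContDiff ℝ 2 (dd n e u) :=
    (hu.fderiv_right (m := 2) (by norm_num)).clm_apply contDiff_const
  have hu2 : ContDiff ℝ 2 u := hu.of_le (by norm_num)
  have hvc := hv.continuous
  set h := quadCutoff R x with hh
  set r := ε * h * R with hr
  have hr0 : 0 < r := by positivity
  have hrR : r ≤ h / 6 * R := by
    rw [hr]
    gcongr
    nlinarith
  have hAx := hA c₂ c₃ K hK u M M' e hu2 he hM hM' x r hr0
  have hDx := hD K hK u M M' e hu2 he hM hM' x r (1 / ε ^ 2) hr0 (by positivity)
  have iSv := hK.integrable_sdiff2_mul hn hs hc₁.le hv hM' x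
  have iSu := hK.integrable_sdiff2_mul hn hs hc₁.le hu2 hM x
  have iw := hK.integrable_sub_sq_mul hn hs hc₁.le (hu.of_le (by norm_num)) hM x
  have iv := hK.integrable_cutoff_mul_sub_sq_mul hn hs hc₁.le (hv.of_le (by norm_num)) hM' x r
  have ig : Integrable (fun z => (1 - cutoff n r z) * K z * dd n e u (x + z)) :=
    (hK.integrable_one_sub_cutoff_mul hn hs hc₁.le hr0).mul_bdd (c := M') (by fun_prop)
      (Eventually.of_forall fun z => hM' _)
  have hcc := (contDiff_cutoff (n := n) (r := r)).continuous
  have hqbd : ∀ z : En n, z ≠ 0 →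
      |cutoff n r z * ‖z‖ ^ 2| ≤ r ^ 2 * min ((r⁻¹ * ‖z‖) ^ 2) 1 := by
    intro z _
    have h0 := cutoff_nonneg (r := r) z
    have h1 := cutoff_le_one (r := r) z
    rw [abs_of_nonneg (by positivity)]
    rcases le_total ‖z‖ r with hz | hz
    · have h2 : r⁻¹ * ‖z‖ ≤ 1 := by rw [inv_mul_le_iff₀ hr0]; linarith
      have h3 : 0 ≤ r⁻¹ * ‖z‖ := by positivity
      rw [min_eq_left (by nlinarith)]
      have h4 : r ^ 2 * (r⁻¹ * ‖z‖) ^ 2 = ‖z‖ ^ 2 := by field_simp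
      rw [h4]
      nlinarith [sq_nonneg ‖z‖]
    · rw [cutoff_eq_zero hr0 hz, zero_mul]
      positivity
  have iq : Integrable (fun z : En n => cutoff n r z * ‖z‖ ^ 2 * K z) :=
    hK.integrable_mul hn hs hc₁.le hr0 (by fun_prop) hqbd
  have hq := hK.integral_mul_le hn hs hc₁.le hr0 (by fun_prop) hqbd
  set v := dd n e u with hvdef
  set Q : En n → ℝ := fun z =>
    2 * h ^ 2 * v x * (sdiff2 v x z * K z)
    + 2 * (τ / R ^ 2) * (u x - a) * (sdiff2 u x z * K z)
    - τ / R ^ 2 * ((u x - u (x + z)) ^ 2 * K z + (u x - u (x + -z)) ^ 2 * K (-z))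
    + 600 * v x ^ 2 / R ^ 2 * (cutoff n r z * ‖z‖ ^ 2 * K z)
    - h ^ 2 / 8 * (cutoff n r z * (v x - v (x + z)) ^ 2 * K z
        + cutoff n r (-z) * (v x - v (x + -z)) ^ 2 * K (-z))
    + 2 * h ^ 2 * v x * ((1 - cutoff n r z) * K z * v (x + z)
        + (1 - cutoff n r (-z)) * K (-z) * v (x + -z)) with hQ
  have hQ0 : 0 ≤ ∫ z, Q z := by
    refine integral_nonneg_of_ae ?_
    filter_upwards [ae_ne_zero hn] with z hz
    have hK0 := hK.nonneg hc₁.le hz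
    have hpt := quadCutoff_pointwise_le hR (z := z) hx hr0 hrR (v x) (v (x + z)) (v (x - z))
    have h1 := hmax (x + z)
    have h2 := hmax (x - z)
    simp only [hQ, Pi.zero_apply]
    rw [← hK.even z hz, cutoff_neg, ← sub_eq_add_neg]
    have h3 : 0 ≤ K z * (2 * h ^ 2 * v x * sdiff2 v x z
        + 2 * (τ / R ^ 2) * (u x - a) * sdiff2 u x z
        - τ / R ^ 2 * ((u x - u (x + z)) ^ 2 + (u x - u (x - z)) ^ 2)
        + cutoff n r z * (600 * v x ^ 2 * (‖z‖ / R) ^ 2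
          - h ^ 2 / 8 * ((v x - v (x + z)) ^ 2 + (v x - v (x - z)) ^ 2))
        + 2 * h ^ 2 * v x * (1 - cutoff n r z) * (v (x + z) + v (x - z))) := by
      have h4 := sdiff2_le_of_max hpt h1 h2
      rw [← add_assoc] at h4
      exact mul_nonneg hK0 h4
    refine h3.trans (le_of_eq ?_)
    rw [div_pow]
    generalize sdiff2 v x z = S₁
    generalize sdiff2 u x z = S₂
    generalize v (x + z) = v₁
    generalize v (x - z) = v₂
    generalize u (x + z) = u₁
    generalize u (x - z) = u₂
    generalize cutoff n r z = χ
    generalize K z = k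
    ring
  have i1 := iSv.const_mul (2 * h ^ 2 * v x)
  have i2 := iSu.const_mul (2 * (τ / R ^ 2) * (u x - a))
  have i3 := (iw.add iw.comp_neg).const_mul (τ / R ^ 2)
  have i4 := iq.const_mul (600 * v x ^ 2 / R ^ 2)
  have i5 := (iv.add iv.comp_neg).const_mul (h ^ 2 / 8)
  have i6 := (ig.add ig.comp_neg).const_mul (2 * h ^ 2 * v x)
  simp only [Pi.add_apply] at i3 i5 i6
  rw [hQ, integral_add_sub_add_sub_add i1 i2 i3 i4 i5 i6] at hQ0
  simp only [integral_const_mul] at hQ0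
  rw [integral_add iw iw.comp_neg, integral_add iv iv.comp_neg, integral_add ig ig.comp_neg,
    integral_neg_eq_self (fun z => (u x - u (x + z)) ^ 2 * K z),
    integral_neg_eq_self (fun z => cutoff n r z * (v x - v (x + z)) ^ 2 * K z),
    integral_neg_eq_self (fun z => (1 - cutoff n r z) * K z * v (x + z))] at hQ0
  unfold symmOp
  set Iw := ∫ z, (u x - u (x + z)) ^ 2 * K z
  set Iv := ∫ z, cutoff n r z * (v x - v (x + z)) ^ 2 * K z
  set T := ∫ z, (1 - cutoff n r z) * K z * v (x + z)
  set B := ∫ z, cutoff n r z * ‖z‖ ^ 2 * K z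
  set Sv := ∫ z, sdiff2 v x z * K z
  set Su := ∫ z, sdiff2 u x z * K z
  have hIv0 : 0 ≤ Iv := integral_nonneg_of_ae (by
    filter_upwards [ae_ne_zero hn] with z hz
    exact mul_nonneg (mul_nonneg (cutoff_nonneg z) (sq_nonneg _)) (hK.nonneg hc₁.le hz))
  have hr2s : r ^ 2 * r ^ (-(2 * s)) = r ^ (2 - 2 * s) := by
    rw [← Real.rpow_natCast r 2, ← Real.rpow_add hr0]
    norm_num
    ring_nf
  set P := r ^ (2 - 2 * s) with hP
  set V := P * v x ^ 2 / R ^ 2 with hV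
  have hP0 : 0 < P := Real.rpow_pos_of_pos hr0 _
  have hV0 : 0 ≤ V := by positivity
  have hB : 600 * v x ^ 2 / R ^ 2 * B ≤ 600 * (c₂ * G) * V := by
    have h1 : r ^ 2 * c₂ * (r ^ (-(2 * s)) * G) = c₂ * G * P := by rw [← hr2s]; ring
    rw [h1] at hq
    calc 600 * v x ^ 2 / R ^ 2 * B ≤ 600 * v x ^ 2 / R ^ 2 * (c₂ * G * P) := by gcongr
      _ = _ := by rw [hV]; ring
  have hT : 4 * h ^ 2 * (v x * T) ≤ 4 / ε ^ 4 / R ^ 2 * Iw + 4 * D * V := by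
    have h1 : r ^ (-(2 * s)) = P / r ^ 2 := by rw [← hr2s]; field_simp
    rw [h1] at hDx
    refine (mul_le_mul_of_nonneg_left hDx (by positivity)).trans (le_of_eq ?_)
    rw [hV, hr]
    field_simp
  have hAV : E * V ≤ h ^ 2 / 4 * Iv + E * A / R ^ 2 * Iw := by
    have h1 : V ≤ A * (r ^ 2 * Iv + Iw) / R ^ 2 := by
      rw [hV]
      gcongr
    have h2 : E * (A * (r ^ 2 * Iv + Iw) / R ^ 2)
        = (E * A * ε ^ 2) * (h ^ 2 * Iv) + E * A / R ^ 2 * Iw := by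
      rw [hr]
      field_simp
    have h3 : (E * A * ε ^ 2) * (h ^ 2 * Iv) ≤ 1 / 4 * (h ^ 2 * Iv) := by gcongr
    have h4 := mul_le_mul_of_nonneg_left h1 (by linarith : 0 ≤ E)
    rw [h2] at h4
    linarith
  have hIw0 : 0 ≤ Iw := integral_nonneg_of_ae (by
    filter_upwards [ae_ne_zero hn] with z hz
    exact mul_nonneg (sq_nonneg _) (hK.nonneg hc₁.le hz))
  have hτw : τ / R ^ 2 * Iw = E * A / R ^ 2 * Iw + 4 / ε ^ 4 / R ^ 2 * Iw := by
    rw [hτ]; ring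
  have hτw0 : 0 ≤ τ / R ^ 2 * Iw := by positivity
  rw [hE] at hAV
  linarith

theorem BernsteinKernel.of_evenPowKernel {n : ℕ} {s C₁ C₂ C₃ : ℝ} {K : En n → ℝ}
    (h : evenPowKernel n s C₁ C₂ K) (h' : kernelDerivBdd n C₃ K) :
    BernsteinKernel n s (C₁ * (s * (1 - s))) (C₂ * (s * (1 - s))) C₃ K where
  even := h.1
  lower z hz := (h.2 z hz).1
  upper z hz := (h.2 z hz).2
  diff z hz := (h'.1.contDiffAt (isOpen_ne.mem_nhds hz)).differentiableAt two_ne_zero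
  deriv_le z hz := by
    have h1 := h'.2 z hz
    have h2 : 0 ≤ ‖z‖ ^ 2 * ‖fderiv ℝ (fderiv ℝ K) z‖ := by positivity
    linarith

theorem BernsteinKernel.sum {n : ℕ} {s c₁ c₂ c₃ : ℝ} {ι : Type*} [Fintype ι] {K : ι → En n → ℝ}
    {w : ι → ℝ} (hK : ∀ j, BernsteinKernel n s c₁ c₂ c₃ (K j)) (hw : ∀ j, 0 ≤ w j)
    (hw1 : ∑ j, w j = 1) : BernsteinKernel n s c₁ c₂ c₃ (fun z => ∑ j, w j * K j z) where
  even z hz := Finset.sum_congr rfl fun j _ => by rw [(hK j).even z hz]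
  lower z hz := by
    rw [← one_mul (c₁ * _), ← hw1, Finset.sum_mul]
    exact Finset.sum_le_sum fun j _ => mul_le_mul_of_nonneg_left ((hK j).lower z hz) (hw j)
  upper z hz := by
    rw [← one_mul (c₂ * _), ← hw1, Finset.sum_mul]
    exact Finset.sum_le_sum fun j _ => mul_le_mul_of_nonneg_left ((hK j).upper z hz) (hw j)
  diff z hz := DifferentiableAt.fun_sum fun j _ => ((hK j).diff z hz).const_mul (w j)
  deriv_le z hz := by
    rw [fderiv_fun_sum fun j _ => ((hK j).diff z hz).const_mul (w j), Finset.mul_sum]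
    refine (mul_le_mul_of_nonneg_left (norm_sum_le _ _) (norm_nonneg z)).trans ?_
    rw [Finset.mul_sum]
    refine Finset.sum_le_sum fun j _ => ?_
    rw [fderiv_const_mul ((hK j).diff z hz), norm_smul, Real.norm_of_nonneg (hw j)]
    have := mul_le_mul_of_nonneg_left ((hK j).deriv_le z hz) (hw j)
    linarith

theorem symmOp_sum {n : ℕ} {ι : Type*} [Fintype ι] {K : ι → En n → ℝ} (w : ι → ℝ) {v : En n → ℝ}
    {x : En n} (hK : ∀ j, Integrable fun z => sdiff2 v x z * K j z) :
    symmOp (fun z => ∑ j, w j * K j z) v x = ∑ j, w j * symmOp (K j) v x := by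
  have h : ∀ z, sdiff2 v x z * ∑ j, w j * K j z = ∑ j, w j * (sdiff2 v x z * K j z) := by
    intro z
    rw [Finset.mul_sum]
    exact Finset.sum_congr rfl fun j _ => by ring
  simp only [symmOp, h]
  rw [integral_finsetSum _ fun j _ => (hK j).const_mul (w j), Finset.mul_sum]
  refine Finset.sum_congr rfl fun j _ => ?_
  rw [integral_const_mul]
  ring

theorem abs_le_of_hasDerivAt_of_sub_le {h : ℝ → ℝ} {d c : ℝ} (hd : HasDerivAt h d 0)
    (hc : ∀ᶠ t in nhds (0:ℝ), h t - h 0 ≤ c * |t|) : |d| ≤ c := by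
  rw [abs_le]
  constructor
  · refine ge_of_tendsto hd.tendsto_slope_zero_left ?_
    filter_upwards [self_mem_nhdsWithin, nhdsWithin_le_nhds hc] with t ht htc
    have ht0 : t < 0 := ht
    rw [abs_of_neg ht0] at htc
    rw [zero_add, smul_eq_mul, ← div_eq_inv_mul, le_div_iff_of_neg ht0]
    linarith
  · refine le_of_tendsto hd.tendsto_slope_zero_right ?_
    filter_upwards [self_mem_nhdsWithin, nhdsWithin_le_nhds hc] with t ht htc
    have ht0 : 0 < t := ht
    rw [abs_of_pos ht0] at htc
    rw [zero_add, smul_eq_mul, ← div_eq_inv_mul, div_le_iff₀ ht0]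
    exact htc

/-- The kernel of the linearization of a convex fully nonlinear equation at a point, together with
the bounds on the linearized operator applied to the solution and to its derivatives. -/
theorem exists_linearized_kernel {n : ℕ} (hn : 0 < n) {s : ℝ} (hs : s ∈ Ioo (0:ℝ) 1)
    {c₁ c₂ c₃ : ℝ} (hc₁ : 0 ≤ c₁) {ι : Type*} [Fintype ι] {K : ι → En n → ℝ}
    (hK : ∀ j, BernsteinKernel n s c₁ c₂ c₃ (K j)) {F : (ι → ℝ) → ℝ} {α : ι → (ι → ℝ) → ℝ}
    {θ : ℝ} (hθ : 0 < θ) (hα : ∀ j p, 0 ≤ α j p) (hαθ : ∀ p, θ ≤ ∑ j, α j p)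
    (hF : ∀ p q : ι → ℝ, ∑ j, α j p * (q j - p j) ≤ F q - F p)
    {U : Set (En n)} (hU : IsOpen U) {f : En n → ℝ} {g : ι → En n → ℝ} {u : En n → ℝ} {M M' : ℝ}
    (hu : ContDiff ℝ 3 u) (hM : ∀ x, |u x| ≤ M) (hM' : ∀ x, ‖fderiv ℝ u x‖ ≤ M')
    (heq : ∀ x ∈ U, F (fun j => opK n (K j) u x - g j x) = f x) {N Lf Ag : ℝ} {Lg : ι → ℝ}
    (hN : 0 ≤ N) (hLf : 0 ≤ Lf) (hLg : ∀ j, 0 ≤ Lg j)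
    (hfN : ∀ x ∈ U, -N ≤ f x + (-F (fun j => -(g j x))))
    (hf : ∀ x ∈ U, ∀ y ∈ U, |f x - f y| ≤ Lf * dist x y)
    (hg : ∀ j, ∀ x ∈ U, ∀ y ∈ U, |g j x - g j y| ≤ Lg j * dist x y)
    (hAg : ∀ p, ∑ j, α j p * Lg j ≤ Ag) {x : En n} (hx : x ∈ U) :
    ∃ L : En n → ℝ, BernsteinKernel n s c₁ c₂ c₃ L ∧ -(N / θ) ≤ symmOp L u x ∧
      ∀ e : En n, ‖e‖ ≤ 1 → |symmOp L (dd n e u) x| ≤ (Lf + Ag) / θ := by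
  have hu2 : ContDiff ℝ 2 u := hu.of_le (by norm_num)
  have hop : ∀ j y, opK n (K j) u y = symmOp (K j) u y := fun j y =>
    (hK j).opK_eq_symmOp hn hs hc₁ hu2 hM y
  simp only [hop] at heq
  set p : ι → ℝ := fun j => symmOp (K j) u x - g j x with hp
  set S := ∑ j, α j p with hS
  have hSθ : θ ≤ S := hαθ p
  have hS0 : 0 < S := hθ.trans_le hSθ
  have hAg0 : 0 ≤ Ag := (Finset.sum_nonneg fun j _ => mul_nonneg (hα j p) (hLg j)).trans (hAg p)
  have hsum : ∀ v : En n → ℝ, (∀ j, Integrable fun z => sdiff2 v x z * K j z) →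
      symmOp (fun z => ∑ j, α j p / S * K j z) v x = (∑ j, α j p * symmOp (K j) v x) / S := by
    intro v hv
    rw [symmOp_sum _ hv, Finset.sum_div]
    exact Finset.sum_congr rfl fun j _ => by ring
  refine ⟨fun z => ∑ j, α j p / S * K j z,
    BernsteinKernel.sum hK (fun j => div_nonneg (hα j p) hS0.le)
      (by rw [← Finset.sum_div, ← hS, div_self hS0.ne']), ?_, ?_⟩
  · rw [hsum u fun j => (hK j).integrable_sdiff2_mul hn hs hc₁ hu2 hM x]
    have h1 := hF p fun j => -(g j x)
    have h2 : ∑ j, α j p * (-(g j x) - p j) = -∑ j, α j p * symmOp (K j) u x := by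
      rw [← Finset.sum_neg_distrib]
      exact Finset.sum_congr rfl fun j _ => by rw [hp]; ring
    rw [h2, heq x hx] at h1
    have h3 := hfN x hx
    have h4 : -N ≤ ∑ j, α j p * symmOp (K j) u x := by linarith
    rw [← neg_div, div_le_div_iff₀ hθ hS0]
    have h5 := mul_le_mul_of_nonneg_right h4 hθ.le
    have h6 := mul_le_mul_of_nonneg_left hSθ hN
    linarith
  · intro e he
    have hv : ContDiff ℝ 2 (dd n e u) :=
      (hu.fderiv_right (m := 2) (by norm_num)).clm_apply contDiff_const
    have hvM : ∀ y, |dd n e u y| ≤ M' := fun y =>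
      (abs_fderiv_apply_le u y he).trans (hM' y)
    rw [hsum _ fun j => (hK j).integrable_sdiff2_mul hn hs hc₁ hv hvM x, abs_div, abs_of_pos hS0]
    have hd : HasDerivAt (fun t : ℝ => ∑ j, α j p * symmOp (K j) u (x + t • e))
        (∑ j, α j p * symmOp (K j) (dd n e u) x) 0 :=
      HasDerivAt.fun_sum fun j _ =>
        ((hK j).hasDerivAt_symmOp hn hs hc₁ hu hM e hvM x).const_mul (α j p)
    have hnear : ∀ᶠ t in nhds (0:ℝ), x + t • e ∈ U := by
      refine (Continuous.tendsto (by fun_prop : Continuous fun t : ℝ => x + t • e) 0).eventually ?_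
      rw [zero_smul, add_zero]
      exact hU.mem_nhds hx
    have habs : |∑ j, α j p * symmOp (K j) (dd n e u) x| ≤ Lf + Ag := by
      refine abs_le_of_hasDerivAt_of_sub_le hd ?_
      filter_upwards [hnear] with t ht
      have hdist : dist (x + t • e) x ≤ |t| := by
        rw [dist_eq_norm, add_sub_cancel_left, norm_smul, Real.norm_eq_abs]
        nlinarith [abs_nonneg t]
      have h1 := hF p fun j => symmOp (K j) u (x + t • e) - g j (x + t • e)
      rw [heq x hx, heq _ ht] at h1
      have h2 : f (x + t • e) - f x ≤ Lf * |t| :=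
        (le_abs_self _).trans ((hf _ ht _ hx).trans (mul_le_mul_of_nonneg_left hdist hLf))
      have h3 : ∑ j, α j p * (g j (x + t • e) - g j x) ≤ Ag * |t| := by
        refine le_trans ?_ (mul_le_mul_of_nonneg_right (hAg p) (abs_nonneg t))
        rw [Finset.sum_mul]
        refine Finset.sum_le_sum fun j _ => ?_
        rw [mul_assoc]
        exact mul_le_mul_of_nonneg_left ((le_abs_self _).trans ((hg j _ ht _ hx).trans
          (mul_le_mul_of_nonneg_left hdist (hLg j)))) (hα j p)
      have h4 : ∑ j, α j p * (symmOp (K j) u (x + t • e) - g j (x + t • e) - p j)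
          = ∑ j, α j p * symmOp (K j) u (x + t • e) - ∑ j, α j p * symmOp (K j) u x
            - ∑ j, α j p * (g j (x + t • e) - g j x) := by
        rw [← Finset.sum_sub_distrib, ← Finset.sum_sub_distrib]
        exact Finset.sum_congr rfl fun j _ => by rw [hp]; ring
      rw [h4] at h1
      simp only [zero_smul, add_zero]
      linarith
    exact div_le_div₀ (by positivity) habs hθ hSθ

theorem sq_le_of_mul_sq_le {P X Γ Y : ℝ} (hP : 0 < P) (h : P * X ^ 2 ≤ 4 * X * Γ + Y) :
    X ^ 2 ≤ 16 * Γ ^ 2 / P ^ 2 + 2 * Y / P := by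
  have h1 : P * X ^ 2 * P ≤ (4 * X * Γ + Y) * P := mul_le_mul_of_nonneg_right h hP.le
  have h2 : 16 * Γ ^ 2 / P ^ 2 + 2 * Y / P = (16 * Γ ^ 2 + 2 * Y * P) / P ^ 2 := by
    field_simp
  rw [h2, le_div_iff₀ (by positivity)]
  nlinarith [sq_nonneg (P * X - 4 * Γ)]

theorem quadCutoff_ge {n : ℕ} {R : ℝ} (hR : 0 < R) {x : En n} (hx : x ∈ ball (0 : En n) (R / 2)) :
    3 / 4 ≤ quadCutoff R x := by
  refine le_trans ?_ (le_max_left _ _)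
  have h1 : ‖x‖ / R ≤ 1 / 2 := by
    rw [div_le_iff₀ hR]
    rw [mem_ball_zero_iff] at hx
    linarith
  have h2 : 0 ≤ ‖x‖ / R := by positivity
  nlinarith

theorem mem_ball_of_quadCutoff_pos {n : ℕ} {R : ℝ} (hR : 0 < R) {x : En n}
    (hx : 0 < quadCutoff R x) : x ∈ ball (0 : En n) R := by
  rw [mem_ball_zero_iff]
  by_contra hcon
  exact hx.ne' (quadCutoff_eq_zero hR (not_lt.1 hcon))

/-- The interior bound for a directional derivative, deduced from the Bernstein inequality at a
maximum and the bounds for the linearized operators. -/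
theorem exists_dd_sq_le {n : ℕ} (hn : 0 < n) {s : ℝ} (hs : s ∈ Ioo (0:ℝ) 1) {c₁ c₂ c₃ : ℝ}
    (hc₁ : 0 < c₁) (hc₂ : 0 ≤ c₂) (hc₃ : 0 ≤ c₃) :
    ∃ τ κ : ℝ, 0 < τ ∧ 0 < κ ∧ ∀ (u : En n → ℝ) (e : En n) (Minf MR M' N Γ R : ℝ),
      ContDiff ℝ 3 u → ‖e‖ ≤ 1 → (∀ x, |u x| ≤ Minf) → (∀ x, |dd n e u x| ≤ M') → 0 < R →
      (∀ x ∈ ball (0 : En n) R, |u x| ≤ MR) → 0 ≤ N → 0 ≤ Γ →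
      (∀ x ∈ ball (0 : En n) R, ∃ L : En n → ℝ, BernsteinKernel n s c₁ c₂ c₃ L ∧
        -N ≤ symmOp L u x ∧ |symmOp L (dd n e u) x| ≤ Γ) →
      ∀ x ∈ ball (0 : En n) (R / 2), dd n e u x ^ 2 ≤ 16 / 9 *
        (16 * Γ ^ 2 / (κ * R ^ (-(2 * s))) ^ 2
          + 2 * (8 * (τ / R ^ 2) * MR * N) / (κ * R ^ (-(2 * s)))
          + 4 * (τ / R ^ 2) * Minf ^ 2) := by
  obtain ⟨τ, ε, hτ, hε, H⟩ := exists_bernstein_at_max hn hs hc₁ hc₂ hc₃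
  refine ⟨τ, ε ^ (2 - 2 * s), hτ, Real.rpow_pos_of_pos hε _, ?_⟩
  intro u e Minf MR M' N Γ R hu he hMinf hM' hR hMR hN hΓ hL x hx
  have hMinf0 : 0 ≤ Minf := (abs_nonneg _).trans (hMinf 0)
  have hMR0 : 0 ≤ MR := (abs_nonneg _).trans (hMR 0 (mem_ball_self hR))
  set P := ε ^ (2 - 2 * s) * R ^ (-(2 * s)) with hP
  have hP0 : 0 < P := by positivity
  set t := τ / R ^ 2 with ht
  have ht0 : 0 < t := by positivity
  have hvc : Continuous (dd n e u) :=
    ((hu.fderiv_right (m := 2) (by norm_num)).clm_apply contDiff_const).continuous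
  have huc := hu.continuous
  set a := min MR Minf with ha
  have haM : a ≤ Minf := min_le_right _ _
  have haR : a ≤ MR := min_le_left _ _
  have ha0 : 0 ≤ a := le_min hMR0 hMinf0
  have hwinf : ∀ y, (u y - a) ^ 2 ≤ 4 * Minf ^ 2 := by
    intro y
    obtain ⟨h1, h2⟩ := abs_le.1 (hMinf y)
    nlinarith
  have hwR : ∀ y ∈ ball (0 : En n) R, -(2 * MR) ≤ u y - a ∧ u y - a ≤ 0 := by
    intro y hy
    obtain ⟨h1, h2⟩ := abs_le.1 (hMR y hy)
    have h3 : u y ≤ a := le_min h2 (abs_le.1 (hMinf y)).2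
    constructor <;> linarith
  set φ : En n → ℝ := fun y => quadCutoff R y ^ 2 * dd n e u y ^ 2 + t * (u y - a) ^ 2 with hφ
  have hηc := continuous_quadCutoff (n := n) R
  have hφc : Continuous φ := by fun_prop
  obtain ⟨x₀, -, hx₀⟩ := (isCompact_closedBall (0 : En n) R).exists_isMaxOn
    (nonempty_closedBall.2 hR.le) hφc.continuousOn
  have hxR : x ∈ closedBall (0 : En n) R := by
    rw [mem_closedBall_zero_iff]
    rw [mem_ball_zero_iff] at hx
    linarith
  have hφx : φ x ≤ φ x₀ := hx₀ hxR
  have hvx : 9 / 16 * dd n e u x ^ 2 ≤ φ x := by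
    have h1 := quadCutoff_ge hR hx
    have h2 : 0 ≤ t * (u x - a) ^ 2 := by positivity
    have h3 : (9 : ℝ) / 16 ≤ quadCutoff R x ^ 2 := by nlinarith
    have h4 := mul_le_mul_of_nonneg_right h3 (sq_nonneg (dd n e u x))
    simp only [hφ]
    linarith
  suffices hmain : φ x₀ ≤ 16 * Γ ^ 2 / P ^ 2 + 2 * (8 * t * MR * N) / P + 4 * t * Minf ^ 2 by
    linarith
  have hnn1 : 0 ≤ 16 * Γ ^ 2 / P ^ 2 := by positivity
  have hnn2 : 0 ≤ 2 * (8 * t * MR * N) / P := by positivity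
  by_cases hcase : φ x₀ ≤ 4 * t * Minf ^ 2
  · linarith
  rw [not_le] at hcase
  have hw0 := mul_le_mul_of_nonneg_left (hwinf x₀) ht0.le
  have hη0 : 0 < quadCutoff R x₀ := by
    refine (quadCutoff_nonneg R x₀).lt_of_ne fun h0 => ?_
    simp only [hφ, ← h0] at hcase
    linarith
  have hmax : ∀ y, φ y ≤ φ x₀ := by
    intro y
    by_cases hy : ‖y‖ ≤ R
    · exact hx₀ (mem_closedBall_zero_iff.2 hy)
    · have h1 := mul_le_mul_of_nonneg_left (hwinf y) ht0.le
      have h2 : φ y = t * (u y - a) ^ 2 := by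
        simp only [hφ, quadCutoff_eq_zero hR (not_le.1 hy).le]
        ring
      rw [h2]
      linarith
  have hx₀R := mem_ball_of_quadCutoff_pos hR hη0
  obtain ⟨L, hLK, hLu, hLv⟩ := hL x₀ hx₀R
  obtain ⟨hwl, hwu⟩ := hwR x₀ hx₀R
  have hB := H L hLK u Minf M' e hu he hMinf hM' R a x₀ hR hη0 hmax
  set η := quadCutoff R x₀ with hη
  have hη1 : η ≤ 1 := quadCutoff_le_one R x₀
  set v := dd n e u x₀ with hv
  have hX : P * (η * |v|) ^ 2 ≤ 4 * (η * |v|) * Γ + 8 * t * MR * N := by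
    have h1 : P * (η * |v|) ^ 2 ≤ (ε * η * R) ^ (2 - 2 * s) * v ^ 2 / R ^ 2 := by
      have e1 : (ε * η * R) ^ (2 - 2 * s)
          = ε ^ (2 - 2 * s) * η ^ (2 - 2 * s) * R ^ (2 - 2 * s) := by
        rw [Real.mul_rpow (by positivity) hR.le, Real.mul_rpow hε.le hη0.le]
      have e2 : R ^ (2 - 2 * s) = R ^ (-(2 * s)) * R ^ 2 := by
        rw [← Real.rpow_natCast R 2, ← Real.rpow_add hR]
        norm_num
        ring_nf
      have e3 : η ^ 2 ≤ η ^ (2 - 2 * s) := by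
        rw [← Real.rpow_natCast η 2]
        refine Real.rpow_le_rpow_of_exponent_ge hη0 hη1 ?_
        norm_num
        exact hs.1.le
      have e4 : (ε * η * R) ^ (2 - 2 * s) * v ^ 2 / R ^ 2 = P * (η ^ (2 - 2 * s) * v ^ 2) := by
        rw [e1, e2, hP]
        field_simp
      rw [e4, mul_pow, sq_abs]
      gcongr
    have h2 : η ^ 2 * v * symmOp L (dd n e u) x₀ ≤ η * |v| * Γ := by
      calc η ^ 2 * v * symmOp L (dd n e u) x₀ ≤ |η ^ 2 * v * symmOp L (dd n e u) x₀| :=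
            le_abs_self _
        _ = η ^ 2 * (|v| * |symmOp L (dd n e u) x₀|) := by
            rw [abs_mul, abs_mul, abs_of_nonneg (sq_nonneg η), mul_assoc]
        _ ≤ η * (|v| * Γ) := by
            gcongr
            nlinarith
        _ = _ := by ring
    have h3 : (u x₀ - a) * symmOp L u x₀ ≤ 2 * MR * N := by
      have g1 := mul_nonneg (sub_nonneg.2 hwu) (sub_nonneg.2 hLu)
      have g2 := mul_nonneg (sub_nonneg.2 hwl) hN
      linarith
    have h4 := mul_le_mul_of_nonneg_left h3 ht0.le
    linarith
  have hX2 := sq_le_of_mul_sq_le hP0 hX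
  rw [mul_pow, sq_abs] at hX2
  have hφ0 : φ x₀ = η ^ 2 * v ^ 2 + t * (u x₀ - a) ^ 2 := rfl
  rw [hφ0]
  linarith

theorem norm_fderiv_le_of_dd_sq_le {n : ℕ} {u : En n → ℝ} {x : En n} {B : ℝ} (hB : 0 ≤ B)
    (h : ∀ e : En n, ‖e‖ ≤ 1 → dd n e u x ^ 2 ≤ B ^ 2) : ‖fderiv ℝ u x‖ ≤ B := by
  refine ContinuousLinearMap.opNorm_le_of_unit_norm hB fun e he => ?_
  exact abs_le_of_sq_le_sq (h e he.le) hB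

theorem le_sq_of_coeff_le {C A₁ A₂ A₃ X Y Z : ℝ} (hC : 1 ≤ C) (hX : 0 ≤ X) (hY : 0 ≤ Y) (hZ : 0 ≤ Z)
    (h1 : A₁ ≤ C) (h2 : A₂ ≤ C) (h3 : A₃ ≤ C) :
    A₁ * X ^ 2 + A₂ * Y ^ 2 + A₃ * Z ^ 2 ≤ (C * X + C * Y + C * Z) ^ 2 := by
  have hC2 : C ≤ C ^ 2 := by nlinarith
  calc A₁ * X ^ 2 + A₂ * Y ^ 2 + A₃ * Z ^ 2 ≤ C ^ 2 * X ^ 2 + C ^ 2 * Y ^ 2 + C ^ 2 * Z ^ 2 := by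
        gcongr <;> linarith
    _ ≤ (C * X + C * Y + C * Z) ^ 2 := by
        have : 0 ≤ C ^ 2 * (X * Y + Y * Z + X * Z) := by positivity
        nlinarith

/-- first derivative bound for convex fully nonlinear equations
`F(𝓛_{K₁}u − g₁, …, 𝓛_{K_J}u − g_J) = f` in `B_R`, built from general kernels, with a
constant `C` depending only on `n, s, C₁, C₂, C₃` and `θ₀`. -/
theorem fully_nonlinear_general_kernels_gradient_estimate (n : ℕ) (hn : 0 < n)
    (s C₁ C₂ C₃ : ℝ) (hs : s ∈ Set.Ioo (0:ℝ) 1)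
    (hC₁ : 0 < C₁) (hC₁₂ : C₁ ≤ C₂) (hC₃ : 0 < C₃)
    (θ₀ : ℝ) (hθ₀ : 0 < θ₀) :
    ∃ C : ℝ, 0 < C ∧
    ∀ (J : ℕ) (K : Fin J → En n → ℝ),
      (∀ j, evenPowKernel n s C₁ C₂ (K j) ∧ kernelDerivBdd n C₃ (K j)) →
    ∀ (F : (Fin J → ℝ) → ℝ) (α : Fin J → (Fin J → ℝ) → ℝ),
      Continuous F →
      (∀ j p, 0 ≤ α j p) →
      (∀ p, θ₀ ≤ ∑ j, α j p) →
      (∀ p q : Fin J → ℝ, ∑ j, α j p * (q j - p j) ≤ F q - F p) →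
    ∀ (R : ℝ), 0 < R →
    ∀ (f : En n → ℝ) (g : Fin J → En n → ℝ) (u : En n → ℝ),
      ContDiff ℝ (⊤ : ℕ∞) u →
      (∃ Mu : ℝ, ∀ x, |u x| ≤ Mu ∧ ‖fderiv ℝ u x‖ ≤ Mu) →
      -- the equation, everywhere in `B_R`
      (∀ x ∈ ball (0 : En n) R, F (fun j => opK n (K j) u x - g j x) = f x) →
    ∀ (Minf MR N₀ Lf Ag : ℝ) (Lg : Fin J → ℝ),
      (∀ x : En n, |u x| ≤ Minf) →
      (∀ x ∈ ball (0 : En n) R, |u x| ≤ MR) →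
      0 ≤ N₀ →
      -- `‖(f+g)₋‖_{L^∞(B_R)} ≤ N₀` where `g = −F(−g₁,…,−g_J)`
      (∀ x ∈ ball (0 : En n) R, -N₀ ≤ f x + (-F (fun j => -(g j x)))) →
      0 ≤ Lf →
      (∀ x ∈ ball (0 : En n) R, ∀ y ∈ ball (0 : En n) R, |f x - f y| ≤ Lf * dist x y) →
      (∀ j, 0 ≤ Lg j) →
      (∀ j, ∀ x ∈ ball (0 : En n) R, ∀ y ∈ ball (0 : En n) R,
        |g j x - g j y| ≤ Lg j * dist x y) →
      (∀ p, ∑ j, α j p * Lg j ≤ Ag) →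
      -- gradient estimate, with `γ₁ = Lf + Ag`
      ∀ x ∈ ball (0 : En n) (R/2),
        ‖fderiv ℝ u x‖ ≤ C * R⁻¹ * Minf
          + C * R ^ (-1 + s) * Real.sqrt N₀ * Real.sqrt MR
          + C * R ^ (2*s) * (Lf + Ag) := by
  have hss : 0 < s * (1 - s) := mul_pos hs.1 (by linarith [hs.2])
  have hc₁ : 0 < C₁ * (s * (1 - s)) := mul_pos hC₁ hss
  have hc₂ : 0 ≤ C₂ * (s * (1 - s)) := mul_nonneg (hC₁.le.trans hC₁₂) hss.le
  obtain ⟨τ, κ, hτ, hκ, H⟩ := exists_dd_sq_le hn hs hc₁ hc₂ hC₃.le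
  set A₁ := 16 / 9 * (4 * τ) with hA₁
  set A₂ := 16 / 9 * (16 * τ / (κ * θ₀)) with hA₂
  set A₃ := 16 / 9 * (16 / (κ * θ₀) ^ 2) with hA₃
  have hA₁0 : 0 ≤ A₁ := by positivity
  have hA₂0 : 0 ≤ A₂ := by positivity
  have hA₃0 : 0 ≤ A₃ := by positivity
  refine ⟨1 + A₁ + A₂ + A₃, by positivity, ?_⟩
  intro J K hK F α hFc hα hαθ hF R hR f g u hu ⟨Mu, hMu⟩ heq Minf MR N₀ Lf Ag Lg hMinf hMR hN₀ hfN
    hLf hf hLg hg hAg x hx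
  have hu3 : ContDiff ℝ 3 u := contDiff_infty.1 hu 3
  have hKB := fun j => BernsteinKernel.of_evenPowKernel (hK j).1 (hK j).2
  have hMinf0 : 0 ≤ Minf := (abs_nonneg _).trans (hMinf 0)
  have hMR0 : 0 ≤ MR := (abs_nonneg _).trans (hMR 0 (mem_ball_self hR))
  have hAg0 : 0 ≤ Ag :=
    (Finset.sum_nonneg fun j _ => mul_nonneg (hα j 0) (hLg j)).trans (hAg 0)
  have hlin := fun y (hy : y ∈ ball (0 : En n) R) => exists_linearized_kernel hn hs hc₁.le hKB hθ₀
    hα hαθ hF isOpen_ball hu3 hMinf (fun z => (hMu z).2) heq hN₀ hLf hLg hfN hf hg hAg hy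
  have hsum : ∀ X Y Z : ℝ, (1 + A₁ + A₂ + A₃) * R⁻¹ * X
      + (1 + A₁ + A₂ + A₃) * R ^ (-1 + s) * Y * Z + (1 + A₁ + A₂ + A₃) * R ^ (2 * s) * (Lf + Ag)
      = (1 + A₁ + A₂ + A₃) * (R⁻¹ * X) + (1 + A₁ + A₂ + A₃) * (R ^ (-1 + s) * Y * Z)
        + (1 + A₁ + A₂ + A₃) * (R ^ (2 * s) * (Lf + Ag)) := fun X Y Z => by ring
  rw [hsum]
  refine norm_fderiv_le_of_dd_sq_le (by positivity) fun e he => ?_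
  have h1 := H u e Minf MR Mu (N₀ / θ₀) ((Lf + Ag) / θ₀) R hu3 he hMinf
    (fun z => (abs_fderiv_apply_le u z he).trans (hMu z).2) hR hMR (by positivity) (by positivity)
    (fun y hy => by
      obtain ⟨L, hL, hLu, hLe⟩ := hlin y hy
      exact ⟨L, hL, hLu, hLe e he⟩) x hx
  refine h1.trans (le_trans (le_of_eq ?_) (le_sq_of_coeff_le (A₁ := A₁) (A₂ := A₂) (A₃ := A₃)
    (by linarith) (by positivity) (by positivity) (by positivity)
    (by linarith) (by linarith) (by linarith)))
  have hR2s : R ^ (2 * s) = (R ^ s) ^ 2 := by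
    rw [← Real.rpow_natCast, ← Real.rpow_mul hR.le]
    ring_nf
  have hRs1 : R ^ (-1 + s) = R⁻¹ * R ^ s := by
    rw [Real.rpow_add hR, Real.rpow_neg_one]
  have hRs0 : 0 < R ^ s := Real.rpow_pos_of_pos hR s
  rw [Real.rpow_neg hR.le, hR2s, hRs1, mul_pow, mul_pow (R⁻¹ * R ^ s * √N₀), mul_pow (R⁻¹ * R ^ s),
    Real.sq_sqrt hN₀, Real.sq_sqrt hMR0, hA₁, hA₂, hA₃]
  field_simp
  ring
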